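/- arXiv:2108.04286 — 3 statements merged into one kernel-verified Lean document; each statement's English description precedes it below -/
import Mathlib

section
/- Let k be an algebraically closed field of characteristic p > 2 and A = U(sl_2(k)) / ⟨e^{p-1}, f^{p-1}⟩. Then the set S = ∪_{k=0}^{p-2} { f^a h^k e^c : 0 ≤ a, c < p-1-k } spans A as a k-vector space. In particular, dim_k A ≤ Σ_{i=1}^{p-1} i^2. -/
namespace Sl2Aux
variable {k A : Type*} [Field k] [Ring A] [Algebra k A]

/-- span of PBW monomials with `h`-degree less than `b` -/
def V (k : Type*) {A : Type*} [Field k] [Ring A] [Algebra k A] (e h f : A) (b : ℕ) :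
    Submodule k A :=
  Submodule.span k {x | ∃ a i c : ℕ, i < b ∧ x = f ^ a * h ^ i * e ^ c}

theorem mon_mem (e h f : A) {b : ℕ} (a i c : ℕ) (hi : i < b) :
    f ^ a * h ^ i * e ^ c ∈ V k e h f b :=
  Submodule.subset_span ⟨a, i, c, hi, rfl⟩

theorem V_mono (e h f : A) {b b' : ℕ} (hb : b ≤ b') : V k e h f b ≤ V k e h f b' := by
  apply Submodule.span_mono
  rintro x ⟨a, i, c, hi, rfl⟩
  exact ⟨a, i, c, by omega, rfl⟩

theorem V_map (e h f : A) {b : ℕ} (φ : A →ₗ[k] A) (W : Submodule k A)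
    (H : ∀ a i c, i < b → φ (f ^ a * h ^ i * e ^ c) ∈ W) {x : A} (hx : x ∈ V k e h f b) :
    φ x ∈ W := by
  have : V k e h f b ≤ W.comap φ := by
    apply Submodule.span_le.2
    rintro x ⟨a, i, c, hi, rfl⟩
    exact H a i c hi
  exact this hx

theorem f_mul (e h f : A) {b : ℕ} {x : A} (hx : x ∈ V k e h f b) : f * x ∈ V k e h f b := by
  refine V_map e h f (LinearMap.mulLeft k f) _ (fun a i c hi => ?_) hx
  have := mon_mem (k := k) e h f (a+1) i c hi
  simpa [pow_succ', mul_assoc] using this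

theorem mul_e (e h f : A) {b : ℕ} {x : A} (hx : x ∈ V k e h f b) : x * e ∈ V k e h f b := by
  refine V_map e h f (LinearMap.mulRight k e) _ (fun a i c hi => ?_) hx
  have := mon_mem (k := k) e h f a i (c+1) hi
  simpa [pow_succ, mul_assoc] using this

theorem fpow_mul (e h f : A) {b : ℕ} {x : A} (hx : x ∈ V k e h f b) (n : ℕ) :
    f ^ n * x ∈ V k e h f b := by
  induction n with
  | zero => simpa
  | succ n ih => rw [pow_succ', mul_assoc]; exact f_mul e h f ih

theorem mul_epow (e h f : A) {b : ℕ} {x : A} (hx : x ∈ V k e h f b) (n : ℕ) :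
    x * e ^ n ∈ V k e h f b := by
  induction n with
  | zero => simpa
  | succ n ih => rw [pow_succ, ← mul_assoc]; exact mul_e e h f ih

theorem h_fpow {h f : A} (hf : h * f = f * h - (2 : k) • f) (a : ℕ) :
    h * f ^ a = f ^ a * h - (2 * a : k) • f ^ a := by
  induction a with
  | zero => simp
  | succ n ih =>
    rw [pow_succ, ← mul_assoc, ih, sub_mul, mul_assoc, hf, mul_sub, mul_smul_comm,
      smul_mul_assoc, ← mul_assoc]
    push_cast
    module

theorem epow_h {e h : A} (he : e * h = h * e - (2 : k) • e) (a : ℕ) :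
    e ^ a * h = h * e ^ a - (2 * a : k) • e ^ a := by
  induction a with
  | zero => simp
  | succ n ih =>
    rw [pow_succ', mul_assoc, ih, mul_sub, ← mul_assoc, he, sub_mul, mul_smul_comm,
      smul_mul_assoc, mul_assoc]
    push_cast
    module

theorem h_mul {e h f : A} (hf : h * f = f * h - (2 : k) • f)
    {b : ℕ} {x : A} (hx : x ∈ V k e h f b) : h * x ∈ V k e h f (b + 1) := by
  refine V_map e h f (LinearMap.mulLeft k h) _ (fun a i c hi => ?_) hx
  have h1 := mon_mem (k := k) e h f (b := b + 1) a (i + 1) c (by omega)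
  have h2 := mon_mem (k := k) e h f (b := b + 1) a i c (by omega)
  have : h * (f ^ a * h ^ i * e ^ c) =
      f ^ a * h ^ (i + 1) * e ^ c - (2 * a : k) • (f ^ a * h ^ i * e ^ c) := by
    rw [← mul_assoc, ← mul_assoc, h_fpow hf, sub_mul, sub_mul, smul_mul_assoc, smul_mul_assoc,
      pow_succ', mul_assoc (f ^ a) h]
  rw [LinearMap.mulLeft_apply, this]
  exact sub_mem h1 (Submodule.smul_mem _ _ h2)

theorem mul_h {e h f : A} (he : e * h = h * e - (2 : k) • e)
    {b : ℕ} {x : A} (hx : x ∈ V k e h f b) : x * h ∈ V k e h f (b + 1) := by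
  refine V_map e h f (LinearMap.mulRight k h) _ (fun a i c hi => ?_) hx
  have h1 := mon_mem (k := k) e h f (b := b + 1) a (i + 1) c (by omega)
  have h2 := mon_mem (k := k) e h f (b := b + 1) a i c (by omega)
  have : (f ^ a * h ^ i * e ^ c) * h =
      f ^ a * h ^ (i + 1) * e ^ c - (2 * c : k) • (f ^ a * h ^ i * e ^ c) := by
    rw [mul_assoc, epow_h he, mul_sub, mul_smul_comm, pow_succ]
    simp only [mul_assoc]
  rw [LinearMap.mulRight_apply, this]
  exact sub_mem h1 (Submodule.smul_mem _ _ h2)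

theorem hpow_mul {e h f : A} (hf : h * f = f * h - (2 : k) • f)
    {b : ℕ} {x : A} (hx : x ∈ V k e h f b) (n : ℕ) : h ^ n * x ∈ V k e h f (b + n) := by
  induction n with
  | zero => simpa
  | succ n ih => rw [pow_succ', mul_assoc]; exact h_mul hf ih

theorem mul_hpow {e h f : A} (he : e * h = h * e - (2 : k) • e)
    {b : ℕ} {x : A} (hx : x ∈ V k e h f b) (n : ℕ) : x * h ^ n ∈ V k e h f (b + n) := by
  induction n with
  | zero => simpa
  | succ n ih => rw [pow_succ, ← mul_assoc]; exact mul_h he ih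

theorem epow_f {e h f : A} (he : e * h = h * e - (2 : k) • e) (hef : e * f = f * e + h) (m : ℕ) :
    e ^ (m + 1) * f = f * e ^ (m + 1) + (m + 1 : k) • (h * e ^ m) -
      ((m + 1) * m : k) • e ^ m := by
  induction m with
  | zero => simp [hef]
  | succ m ih =>
    rw [pow_succ', mul_assoc, ih, mul_sub, mul_add, ← mul_assoc, hef, mul_smul_comm,
      mul_smul_comm, ← mul_assoc e h, he, add_mul, sub_mul, smul_mul_assoc, mul_assoc, mul_assoc,
      ← pow_succ', ← pow_succ']
    push_cast
    module

theorem e_fpow {e h f : A} (hf : h * f = f * h - (2 : k) • f) (hef : e * f = f * e + h) (m : ℕ) :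
    e * f ^ (m + 1) = f ^ (m + 1) * e + (m + 1 : k) • (f ^ m * h) -
      ((m + 1) * m : k) • f ^ m := by
  induction m with
  | zero => simp [hef]
  | succ m ih =>
    rw [pow_succ f (m + 1), ← mul_assoc, ih, sub_mul, add_mul, mul_assoc, hef, smul_mul_assoc,
      smul_mul_assoc, mul_assoc _ h, hf, mul_add, mul_sub, mul_smul_comm, ← mul_assoc, ← mul_assoc,
      ← pow_succ, ← pow_succ]
    push_cast
    module

theorem hpow_f {e h f : A} (hf : h * f = f * h - (2 : k) • f) (i : ℕ) :
    h ^ i * f ∈ V k e h f (i + 1) := by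
  have h1 := mon_mem (k := k) e h f (b := 1) 1 0 0 (by omega)
  have := hpow_mul hf h1 i
  rw [add_comm i]
  simpa using this

theorem e_hpow {e h f : A} (he : e * h = h * e - (2 : k) • e) (i : ℕ) :
    e * h ^ i ∈ V k e h f (i + 1) := by
  have h1 := mon_mem (k := k) e h f (b := 1) 0 0 1 (by omega)
  have := mul_hpow he h1 i
  rw [add_comm i]
  simpa using this

theorem mul_f {e h f : A} (he : e * h = h * e - (2 : k) • e) (hf : h * f = f * h - (2 : k) • f)
    (hef : e * f = f * e + h)
    {b : ℕ} {x : A} (hx : x ∈ V k e h f b) : x * f ∈ V k e h f (b + 1) := by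
  refine V_map e h f (LinearMap.mulRight k f) _ (fun a i c hi => ?_) hx
  have h0 := V_mono e h f (show i + 1 ≤ b + 1 by omega)
    (mul_epow e h f (fpow_mul e h f (hpow_f (k := k) (e := e) hf i) a) c)
  rw [LinearMap.mulRight_apply]
  cases c with
  | zero => simpa [mul_assoc] using h0
  | succ c =>
    have h1 := mon_mem (k := k) e h f (b := b + 1) a (i + 1) c (by omega)
    have h2 := mon_mem (k := k) e h f (b := b + 1) a i c (by omega)
    rw [mul_assoc, epow_f he hef, mul_sub, mul_add, mul_smul_comm, mul_smul_comm]
    refine sub_mem (add_mem ?_ (Submodule.smul_mem _ _ ?_)) (Submodule.smul_mem _ _ h2)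
    · simpa only [mul_assoc] using h0
    · simpa only [mul_assoc, pow_succ] using h1

theorem e_mul {e h f : A} (he : e * h = h * e - (2 : k) • e) (hf : h * f = f * h - (2 : k) • f)
    (hef : e * f = f * e + h)
    {b : ℕ} {x : A} (hx : x ∈ V k e h f b) : e * x ∈ V k e h f (b + 1) := by
  refine V_map e h f (LinearMap.mulLeft k e) _ (fun a i c hi => ?_) hx
  have h0 := V_mono e h f (show i + 1 ≤ b + 1 by omega)
    (mul_epow e h f (fpow_mul e h f (e_hpow (k := k) (f := f) he i) a) c)
  rw [LinearMap.mulLeft_apply]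
  cases a with
  | zero => simpa [mul_assoc] using h0
  | succ a =>
    have h1 := mon_mem (k := k) e h f (b := b + 1) a (i + 1) c (by omega)
    have h2 := mon_mem (k := k) e h f (b := b + 1) a i c (by omega)
    rw [← mul_assoc, ← mul_assoc, e_fpow hf hef, sub_mul, add_mul, smul_mul_assoc, smul_mul_assoc,
      sub_mul, add_mul, smul_mul_assoc, smul_mul_assoc]
    refine sub_mem (add_mem ?_ (Submodule.smul_mem _ _ ?_)) (Submodule.smul_mem _ _ h2)
    · simpa only [mul_assoc] using h0
    · simpa only [mul_assoc, pow_succ'] using h1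

theorem right_rel {e h f : A} (he : e * h = h * e - (2 : k) • e)
    (hf : h * f = f * h - (2 : k) • f) (hef : e * f = f * e + h) {n : ℕ} (hn : e ^ n = 0)
    (hc : ∀ m : ℕ, m < n → (m + 1 : k) ≠ 0) (j : ℕ) : ∀ m, j + m = n →
    h ^ j * e ^ m ∈ V k e h f j := by
  induction j with
  | zero => intro m hm; obtain rfl : m = n := by omega
            simp [hn]
  | succ j ih =>
    intro m hm
    have h1 := mul_f he hf hef (ih (m + 1) (by omega))
    have h2 := mul_epow e h f (hpow_f (k := k) (e := e) hf j) (m + 1)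
    have h3 := mon_mem (k := k) e h f (b := j + 1) 0 j m (by omega)
    rw [pow_zero, one_mul] at h3
    have h4 : (m + 1 : k) • (h ^ (j + 1) * e ^ m) = h ^ j * e ^ (m + 1) * f
        - h ^ j * f * e ^ (m + 1) + ((m + 1) * m : k) • (h ^ j * e ^ m) := by
      rw [mul_assoc _ _ f, epow_f he hef, mul_sub, mul_add, mul_smul_comm, mul_smul_comm, pow_succ]
      simp only [mul_assoc]
      abel
    rw [← Submodule.smul_mem_iff _ (hc m (by omega)), h4]
    exact add_mem (sub_mem h1 h2) (Submodule.smul_mem _ _ h3)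

theorem left_rel {e h f : A} (he : e * h = h * e - (2 : k) • e)
    (hf : h * f = f * h - (2 : k) • f) (hef : e * f = f * e + h) {n : ℕ} (hn : f ^ n = 0)
    (hc : ∀ m : ℕ, m < n → (m + 1 : k) ≠ 0) (j : ℕ) : ∀ m, j + m = n →
    f ^ m * h ^ j ∈ V k e h f j := by
  induction j with
  | zero => intro m hm; obtain rfl : m = n := by omega
            simp [hn]
  | succ j ih =>
    intro m hm
    have h1 := e_mul he hf hef (ih (m + 1) (by omega))
    have h2 := fpow_mul e h f (e_hpow (k := k) (f := f) he j) (m + 1)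
    have h3 := mon_mem (k := k) e h f (b := j + 1) m j 0 (by omega)
    rw [pow_zero, mul_one] at h3
    have h4 : (m + 1 : k) • (f ^ m * h ^ (j + 1)) = e * (f ^ (m + 1) * h ^ j)
        - f ^ (m + 1) * (e * h ^ j) + ((m + 1) * m : k) • (f ^ m * h ^ j) := by
      rw [← mul_assoc e, e_fpow hf hef, sub_mul, add_mul, smul_mul_assoc, smul_mul_assoc, pow_succ']
      simp only [mul_assoc]
      abel
    rw [← Submodule.smul_mem_iff _ (hc m (by omega)), h4]
    exact add_mem (sub_mem h1 h2) (Submodule.smul_mem _ _ h3)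

theorem V_le {e h f : A} (he : e * h = h * e - (2 : k) • e)
    (hf : h * f = f * h - (2 : k) • f) (hef : e * f = f * e + h) {n : ℕ} (hen : e ^ n = 0)
    (hfn : f ^ n = 0) (hc : ∀ m : ℕ, m < n → (m + 1 : k) ≠ 0) (b : ℕ) :
    V k e h f b ≤ Submodule.span k
      {x | ∃ a b c : ℕ, b ≤ n - 1 ∧ a < n - b ∧ c < n - b ∧ x = f ^ a * h ^ b * e ^ c} := by
  induction b with
  | zero => apply Submodule.span_le.2; rintro x ⟨a, i, c, hi, rfl⟩; omega
  | succ b ih =>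
    apply Submodule.span_le.2
    rintro x ⟨a, i, c, hi, rfl⟩
    have hib : V k e h f i ≤ V k e h f b := V_mono e h f (by omega)
    by_cases h1 : a < n - i
    · by_cases h2 : c < n - i
      · exact Submodule.subset_span ⟨a, i, c, by omega, h1, h2, rfl⟩
      · apply ih; apply hib
        obtain hcn | hcn := lt_or_ge n c
        · obtain ⟨d, rfl⟩ := Nat.exists_eq_add_of_lt hcn
          simp [pow_add, hen]
        · obtain ⟨j, rfl⟩ := Nat.exists_eq_add_of_le hcn
          obtain ⟨l, rfl⟩ := Nat.exists_eq_add_of_le (show j ≤ i by omega)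
          have := fpow_mul e h f (hpow_mul hf (right_rel he hf hef hen hc j c (by omega)) l) a
          rw [add_comm j l, pow_add]
          rw [add_comm j l] at this
          simpa only [mul_assoc] using this
    · apply ih; apply hib
      obtain hcn | hcn := lt_or_ge n a
      · obtain ⟨d, rfl⟩ := Nat.exists_eq_add_of_lt hcn
        simp [pow_add, hfn]
      · obtain ⟨j, rfl⟩ := Nat.exists_eq_add_of_le hcn
        obtain ⟨l, rfl⟩ := Nat.exists_eq_add_of_le (show j ≤ i by omega)
        have := mul_epow e h f (mul_hpow he (left_rel he hf hef hfn hc j a (by omega)) l) c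
        rw [pow_add]
        simpa only [mul_assoc] using this

theorem span_eq_top {e h f : A} (he : e * h = h * e - (2 : k) • e)
    (hf : h * f = f * h - (2 : k) • f) (hef : e * f = f * e + h) {n : ℕ} (hen : e ^ n = 0)
    (hfn : f ^ n = 0) (hc : ∀ m : ℕ, m < n → (m + 1 : k) ≠ 0)
    (hgen : Algebra.adjoin k {e, h, f} = ⊤) :
    Submodule.span k
      {x : A | ∃ a b c : ℕ, b ≤ n - 1 ∧ a < n - b ∧ c < n - b ∧ x = f ^ a * h ^ b * e ^ c} = ⊤ := by
  rw [eq_top_iff]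
  rintro x -
  have hx : x ∈ Algebra.adjoin k {e, h, f} := hgen ▸ Algebra.mem_top
  have key : ∀ b, ∀ y ∈ V k e h f b, ∃ b', x * y ∈ V k e h f b' := by
    induction hx using Algebra.adjoin_induction with
    | mem x hx =>
      intro b y hy
      rcases hx with rfl | rfl | rfl
      · exact ⟨_, e_mul he hf hef hy⟩
      · exact ⟨_, h_mul hf hy⟩
      · exact ⟨_, f_mul _ _ _ hy⟩
    | algebraMap r =>
      intro b y hy
      exact ⟨b, by rw [← Algebra.smul_def]; exact Submodule.smul_mem _ _ hy⟩
    | add x z _ _ hx hz =>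
      intro b y hy
      obtain ⟨b1, h1⟩ := hx b y hy
      obtain ⟨b2, h2⟩ := hz b y hy
      exact ⟨max b1 b2, by
        rw [add_mul]
        exact add_mem (V_mono _ _ _ (le_max_left _ _) h1) (V_mono _ _ _ (le_max_right _ _) h2)⟩
    | mul x z _ _ hx hz =>
      intro b y hy
      obtain ⟨b2, h2⟩ := hz b y hy
      obtain ⟨b1, h1⟩ := hx b2 _ h2
      exact ⟨b1, by rwa [mul_assoc]⟩
  obtain ⟨b, hb⟩ := key 1 1 (by simpa using mon_mem (k := k) e h f (b := 1) 0 0 0 (by omega))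
  rw [mul_one] at hb
  exact V_le he hf hef hen hfn hc b hb

theorem rank_le {e h f : A} {n : ℕ} (htop : Submodule.span k
      {x : A | ∃ a b c : ℕ, b ≤ n - 1 ∧ a < n - b ∧ c < n - b ∧ x = f ^ a * h ^ b * e ^ c} = ⊤) :
    Module.rank k A ≤ (↑(∑ i ∈ Finset.Icc 1 n, i ^ 2) : Cardinal) := by
  classical
  let T : Finset (Σ _ : ℕ, ℕ × ℕ) :=
    (Finset.Icc 1 n).sigma fun i => Finset.range i ×ˢ Finset.range i
  let g : (Σ _ : ℕ, ℕ × ℕ) → A := fun t => f ^ t.2.1 * h ^ (n - t.1) * e ^ t.2.2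
  have hT : T.card = ∑ i ∈ Finset.Icc 1 n, i ^ 2 := by
    simp [T, Finset.card_sigma, sq]
  have hsub : {x : A | ∃ a b c : ℕ, b ≤ n - 1 ∧ a < n - b ∧ c < n - b ∧
      x = f ^ a * h ^ b * e ^ c} ⊆ (T.image g : Finset A) := by
    rintro x ⟨a, b, c, hb, ha, hc, rfl⟩
    simp only [Finset.coe_image, Set.mem_image, Finset.mem_coe]
    refine ⟨⟨n - b, a, c⟩, ?_, ?_⟩
    · simp [T]; omega
    · have : n - (n - b) = b := by omega
      simp [g, this]
  have h2 : Submodule.span k ((T.image g : Finset A) : Set A) = ⊤ :=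
    top_le_iff.1 (htop ▸ Submodule.span_mono hsub)
  have h3 := rank_span_finset_le (R := k) (T.image g)
  rw [h2, rank_top] at h3
  refine h3.trans ?_
  rw [← hT]
  exact_mod_cast Finset.card_image_le

section
attribute [local instance] LieRing.ofAssociativeRing

theorem uea_adjoin (k : Type*) [Field k] (L : Type*) [LieRing L] [LieAlgebra k L] :
    Algebra.adjoin k (Set.range (UniversalEnvelopingAlgebra.ι k : L → _)) = ⊤ := by
  set B := Algebra.adjoin k (Set.range (UniversalEnvelopingAlgebra.ι k : L → _)) with hB
  let j : L →ₗ⁅k⁆ B :=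
    { toFun := fun x => ⟨UniversalEnvelopingAlgebra.ι k x, Algebra.subset_adjoin ⟨x, rfl⟩⟩
      map_add' := fun x y => Subtype.ext (by simp)
      map_smul' := fun r x => Subtype.ext (by simp)
      map_lie' := fun {x y} => Subtype.ext (by
        simp [LieRing.of_associative_ring_bracket]) }
  have h : B.val.comp (UniversalEnvelopingAlgebra.lift k j) = AlgHom.id k _ := by
    apply UniversalEnvelopingAlgebra.hom_ext
    ext x
    simp [j]
  rw [eq_top_iff]
  rintro x -
  have h2 := AlgHom.congr_fun h x
  have h3 : ((UniversalEnvelopingAlgebra.lift k j x : B) : UniversalEnvelopingAlgebra k L) = x := h2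
  rw [← h3]
  exact Subtype.property _

theorem iota_comm {k : Type*} [Field k] {L : Type*} [LieRing L] [LieAlgebra k L] (x y z : L)
    (h : ⁅x, y⁆ = z) :
    (UniversalEnvelopingAlgebra.ι k x : UniversalEnvelopingAlgebra k L) *
      UniversalEnvelopingAlgebra.ι k y = UniversalEnvelopingAlgebra.ι k y *
      UniversalEnvelopingAlgebra.ι k x + UniversalEnvelopingAlgebra.ι k z := by
  rw [← h, LieHom.map_lie, LieRing.of_associative_ring_bracket]
  abel

end

end Sl2Aux


open UniversalEnvelopingAlgebra in
/-- The relation whose `RingQuot` is `A = U(sl₂(k)) / ⟨e^{p-1}, f^{p-1}⟩`. -/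
def sl2QuotRel (k : Type*) [Field k] (p : ℕ)
    (L : Type*) [LieRing L] [LieAlgebra k L] (E F : L) :
    UniversalEnvelopingAlgebra k L → UniversalEnvelopingAlgebra k L → Prop :=
  fun a b => (a = (ι k E : UniversalEnvelopingAlgebra k L) ^ (p - 1) ∨
      a = (ι k F : UniversalEnvelopingAlgebra k L) ^ (p - 1)) ∧ b = 0

/-- Let `k` be algebraically closed of characteristic `p > 2` and
`A = U(sl₂(k)) / ⟨e^{p-1}, f^{p-1}⟩`.  The set
`S = ⋃_{b=0}^{p-2} { f^a h^b e^c : 0 ≤ a, c < p-1-b }` of images of PBW monomials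
spans `A` as a `k`-vector space; in particular `dim_k A ≤ ∑_{i=1}^{p-1} i²`. -/
theorem monomials_span_A
    (k : Type*) [Field k] [IsAlgClosed k] (p : ℕ) (hp : p.Prime) (hp2 : 2 < p)
    [CharP k p]
    (L : Type*) [LieRing L] [LieAlgebra k L] (E H F : L)
    (hHE : ⁅H, E⁆ = (2 : k) • E) (hHF : ⁅H, F⁆ = (-2 : k) • F) (hEF : ⁅E, F⁆ = H)
    (hspan : Submodule.span k {E, H, F} = ⊤) :
    Submodule.span k
        { x : RingQuot (sl2QuotRel k p L E F) |
          ∃ a b c : ℕ, b ≤ p - 2 ∧ a < p - 1 - b ∧ c < p - 1 - b ∧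
            x = (RingQuot.mkRingHom (sl2QuotRel k p L E F)
                  (UniversalEnvelopingAlgebra.ι k F)) ^ a *
                (RingQuot.mkRingHom (sl2QuotRel k p L E F)
                  (UniversalEnvelopingAlgebra.ι k H)) ^ b *
                (RingQuot.mkRingHom (sl2QuotRel k p L E F)
                  (UniversalEnvelopingAlgebra.ι k E)) ^ c } = ⊤ ∧
      Module.rank k (RingQuot (sl2QuotRel k p L E F)) ≤
        (↑(∑ i ∈ Finset.Icc 1 (p - 1), i ^ 2) : Cardinal) := by
  classical
  set r := sl2QuotRel k p L E F with hr
  let q := (RingQuot.mkAlgHom k r)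
  let i : L → UniversalEnvelopingAlgebra k L := fun x => UniversalEnvelopingAlgebra.ι k x
  have hq : ∀ x, RingQuot.mkRingHom r x = q x := fun x => by
    rw [← RingQuot.mkAlgHom_coe k r]; rfl
  simp only [hq]
  have h1 := congrArg q (Sl2Aux.iota_comm (k := k) H E _ hHE)
  have h2 := congrArg q (Sl2Aux.iota_comm (k := k) H F _ hHF)
  have h3 := congrArg q (Sl2Aux.iota_comm (k := k) E F _ hEF)
  simp only [map_mul, map_add, map_smul] at h1 h2 h3
  have he : q (UniversalEnvelopingAlgebra.ι k E) * q (UniversalEnvelopingAlgebra.ι k H) =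
      q (UniversalEnvelopingAlgebra.ι k H) * q (UniversalEnvelopingAlgebra.ι k E) -
        (2 : k) • q (UniversalEnvelopingAlgebra.ι k E) := by
    rw [h1]; abel
  have hf : q (UniversalEnvelopingAlgebra.ι k H) * q (UniversalEnvelopingAlgebra.ι k F) =
      q (UniversalEnvelopingAlgebra.ι k F) * q (UniversalEnvelopingAlgebra.ι k H) -
        (2 : k) • q (UniversalEnvelopingAlgebra.ι k F) := by
    rw [h2]; module
  have hen : q (UniversalEnvelopingAlgebra.ι k E) ^ (p - 1) = 0 := by
    rw [← map_pow, ← map_zero q]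
    exact RingQuot.mkAlgHom_rel k ⟨Or.inl rfl, rfl⟩
  have hfn : q (UniversalEnvelopingAlgebra.ι k F) ^ (p - 1) = 0 := by
    rw [← map_pow, ← map_zero q]
    exact RingQuot.mkAlgHom_rel k ⟨Or.inr rfl, rfl⟩
  have hc : ∀ m : ℕ, m < p - 1 → (m + 1 : k) ≠ 0 := by
    intro m hm h0
    have h4 : ((m + 1 : ℕ) : k) = 0 := by exact_mod_cast h0
    have := Nat.le_of_dvd (by omega) ((CharP.cast_eq_zero_iff k p (m + 1)).1 h4)
    omega
  have hgen : Algebra.adjoin k {q (UniversalEnvelopingAlgebra.ι k E),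
      q (UniversalEnvelopingAlgebra.ι k H), q (UniversalEnvelopingAlgebra.ι k F)} = ⊤ := by
    set C := Algebra.adjoin k {q (UniversalEnvelopingAlgebra.ι k E),
      q (UniversalEnvelopingAlgebra.ι k H), q (UniversalEnvelopingAlgebra.ι k F)} with hC
    have hL : ∀ x : L, q (UniversalEnvelopingAlgebra.ι k x) ∈ C := by
      intro x
      have hx : x ∈ Submodule.span k {E, H, F} := hspan ▸ Submodule.mem_top
      induction hx using Submodule.span_induction with
      | mem x hx =>
        apply Algebra.subset_adjoin
        rcases hx with rfl | rfl | rfl <;> simp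
      | zero => simp
      | add x y _ _ hx hy => rw [map_add, map_add]; exact add_mem hx hy
      | smul c x _ hx =>
        rw [map_smul, map_smul]; exact Subalgebra.smul_mem _ hx c
    have hU : Algebra.adjoin k (Set.range (UniversalEnvelopingAlgebra.ι k : L → _)) ≤
        C.comap q := by
      apply Algebra.adjoin_le
      rintro _ ⟨x, rfl⟩
      exact hL x
    rw [Sl2Aux.uea_adjoin] at hU
    rw [eq_top_iff]
    rintro y -
    obtain ⟨x, rfl⟩ := RingQuot.mkAlgHom_surjective k r y
    exact hU (Algebra.mem_top (x := x))
  have htop := Sl2Aux.span_eq_top he hf h3 hen hfn hc hgen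
  have hrank := Sl2Aux.rank_le htop
  exact ⟨htop, hrank⟩
end

section
/- Let k be an algebraically closed field of characteristic p > 2, let M be a finite-dimensional module over sl_2(k) on which e^{p-1} and f^{p-1} act as zero. Then M is a semisimple sl_2(k)-module, isomorphic to a direct sum of the simple modules V(0), ..., V(p-2). -/
section Helpers

/-- Vectorwise form of an `sl₂`-triple of endomorphisms. -/
structure SlTriple {k M : Type*} [Field k] [AddCommGroup M] [Module k M]
    (E H F : Module.End k M) : Prop where
  he : ∀ x, H (E x) = E (H x) + (2 : k) • E x
  hf : ∀ x, H (F x) = F (H x) - (2 : k) • F x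
  ef : ∀ x, E (F x) = F (E x) + H x

variable {k M : Type*} [Field k] [AddCommGroup M] [Module k M] {E H F : Module.End k M}

namespace SlTriple

theorem swap (T : SlTriple E H F) : SlTriple F (-H) E where
  he x := by simp only [LinearMap.neg_apply, T.hf, map_neg]; module
  hf x := by simp only [LinearMap.neg_apply, T.he, map_neg]; module
  ef x := by simp only [LinearMap.neg_apply, T.ef]; module

theorem H_pow (T : SlTriple E H F) (n : ℕ) (x : M) :
    H ((F ^ n) x) = (F ^ n) (H x) - (2 * n : k) • (F ^ n) x := by
  induction n with
  | zero => simp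
  | succ n ih =>
    simp only [pow_succ', Module.End.mul_apply, T.hf, ih, map_sub, map_smul]
    push_cast
    module

theorem E_pow (T : SlTriple E H F) (n : ℕ) (x : M) :
    E ((F ^ (n + 1)) x) = (F ^ (n + 1)) (E x) +
      ((n : k) + 1) • (F ^ n) (H x - (n : k) • x) := by
  induction n with
  | zero => simp [T.ef]
  | succ n ih =>
    rw [pow_succ' F (n + 1), Module.End.mul_apply, T.ef, ih, T.H_pow]
    simp only [pow_succ' F, Module.End.mul_apply, map_add, map_sub, map_smul]
    push_cast
    module

theorem F_pow (T : SlTriple E H F) (n : ℕ) (x : M) :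
    F ((E ^ (n + 1)) x) = (E ^ (n + 1)) (F x) -
      ((n : k) + 1) • (E ^ n) (H x + (n : k) • x) := by
  rw [T.swap.E_pow]
  simp only [LinearMap.neg_apply, map_add, map_sub, map_smul, map_neg]
  module

/-- Raising operator on a string. -/
theorem E_string (T : SlTriple E H F) {u : M} {c : k} (hE : E u = 0) (hH : H u = c • u) (n : ℕ) :
    E ((F ^ (n + 1)) u) = (((n : k) + 1) * (c - n)) • (F ^ n) u := by
  rw [T.E_pow, hE, hH]
  simp only [map_zero, map_sub, map_smul]
  module

theorem H_string (T : SlTriple E H F) {u : M} {c : k} (hH : H u = c • u) (n : ℕ) :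
    H ((F ^ n) u) = (c - 2 * n) • (F ^ n) u := by
  rw [T.H_pow, hH]
  simp only [map_smul]
  module

end SlTriple

theorem cast_ne_zero_of_lt {p : ℕ} [CharP k p] {m : ℕ} (h0 : 0 < m) (h : m < p) :
    (m : k) ≠ 0 := by
  rw [Ne, CharP.cast_eq_zero_iff k p]
  exact Nat.not_dvd_of_pos_of_lt h0 h

theorem cast_sub_ne_zero {p : ℕ} [CharP k p] {a b : ℕ} (h0 : b < a) (h : a < p) :
    (a : k) - b ≠ 0 := by
  rw [← Nat.cast_sub h0.le]
  exact cast_ne_zero_of_lt (p := p) (by omega) (by omega)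

namespace SlTriple

theorem inj (T : SlTriple E H F) {p : ℕ} [CharP k p] {m : ℕ} (hm : m < p) {u : M}
    (hE : E u = 0) (hH : H u = (m : k) • u) (j : ℕ) (hj : j ≤ m) (h : (F ^ j) u = 0) : u = 0 := by
  induction j with
  | zero => simpa using h
  | succ j ih =>
    apply ih (by omega)
    have := T.E_string hE hH j
    rw [h, map_zero] at this
    refine (smul_eq_zero.1 this.symm).resolve_left (mul_ne_zero ?_ ?_)
    · have := cast_ne_zero_of_lt (k := k) (p := p) (m := j + 1) (by omega) (by omega)
      exact_mod_cast this
    · exact cast_sub_ne_zero (p := p) (by omega) hm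

theorem F_kill (T : SlTriple E H F) {p : ℕ} [CharP k p] (hF : F ^ (p - 1) = 0)
    {d : ℕ} (hd : d + 2 ≤ p) {v : M}
    (hE : E v = 0) (hH : H v = (d : k) • v) : (F ^ (d + 1)) v = 0 := by
  obtain ⟨d', rfl⟩ := Nat.exists_eq_add_of_le hd
  have hp : (d : k) + 2 + d' = 0 := by
    have := CharP.cast_eq_zero k (d + 2 + d')
    exact_mod_cast this
  apply T.inj (p := d + 2 + d') (m := d') (by omega) (j := d')
  · rw [T.E_string hE hH]; simp
  · rw [T.H_string hH]
    congr 1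
    push_cast
    linear_combination -hp
  · exact le_rfl
  · rw [← Module.End.mul_apply, ← pow_add, show d' + (d + 1) = d + 2 + d' - 1 by omega, hF]; simp

end SlTriple

/-- Span of the eigenvectors in `K` with eigenvalue a natural number below `n`. -/
def eigSpan (H : Module.End k M) (K : Submodule k M) (n : ℕ) : Submodule k M :=
  Submodule.span k {u | u ∈ K ∧ ∃ i < n, H u = (i : k) • u}

theorem eigSpan_le (H : Module.End k M) (K : Submodule k M) (n : ℕ) : eigSpan H K n ≤ K :=
  Submodule.span_le.2 fun _ h => h.1

theorem eigSpan_mono (H : Module.End k M) (K : Submodule k M) {n m : ℕ} (h : n ≤ m) :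
    eigSpan H K n ≤ eigSpan H K m :=
  Submodule.span_mono fun _ ⟨h1, i, hi, h2⟩ => ⟨h1, i, by omega, h2⟩

theorem eigSpan_solve (H : Module.End k M) (K : Submodule k M) (n : ℕ) (c : k) {y : M}
    (hy : y ∈ eigSpan H K n) :
    ∃ w ∈ eigSpan H K n, ∃ z ∈ eigSpan H K n, y = (H w - c • w) + z ∧ H z = c • z ∧
      ((∀ i < n, (i : k) ≠ c) → z = 0) := by
  unfold eigSpan at hy
  induction hy using Submodule.span_induction with
  | mem u hu =>
    have hus : u ∈ eigSpan H K n := Submodule.subset_span hu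
    obtain ⟨hK, i, hi, hH⟩ := hu
    by_cases hc : (i : k) = c
    · exact ⟨0, zero_mem _, u, hus, by simp, hc ▸ hH, fun h => absurd hc (h i hi)⟩
    · refine ⟨((i : k) - c)⁻¹ • u, Submodule.smul_mem _ _ hus, 0, zero_mem _, ?_, by simp,
        fun _ => rfl⟩
      have : (i : k) - c ≠ 0 := sub_ne_zero.2 hc
      rw [map_smul, hH, smul_comm, smul_smul, smul_smul, ← sub_smul, add_zero]
      rw [show (i : k) * ((i : k) - c)⁻¹ - c * ((i : k) - c)⁻¹ = 1 by field_simp, one_smul]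
  | zero => exact ⟨0, zero_mem _, 0, zero_mem _, by simp, by simp, fun _ => rfl⟩
  | add x y _ _ hx hy =>
    obtain ⟨w, hw, z, hz, h1, h2, h3⟩ := hx
    obtain ⟨w', hw', z', hz', h1', h2', h3'⟩ := hy
    refine ⟨w + w', add_mem hw hw', z + z', add_mem hz hz', ?_, ?_, ?_⟩
    · rw [h1, h1', map_add]; module
    · rw [map_add, h2, h2']; module
    · intro h; rw [h3 h, h3' h, add_zero]
  | smul a x _ hx =>
    obtain ⟨w, hw, z, hz, h1, h2, h3⟩ := hx
    refine ⟨a • w, Submodule.smul_mem _ _ hw, a • z, Submodule.smul_mem _ _ hz, ?_, ?_, ?_⟩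
    · rw [h1, map_smul]; module
    · rw [map_smul, h2]; module
    · intro h; rw [h3 h, smul_zero]

namespace SlTriple

theorem mem_eigSpan (T : SlTriple E H F) {p : ℕ} [CharP k p] (K : Submodule k M)
    (hKE : ∀ x ∈ K, E x = 0) (hKH : ∀ x ∈ K, H x ∈ K) (n : ℕ) (hn : n < p) (x : M) (hx : x ∈ K)
    (h : (E ^ n) ((F ^ n) x) = 0) : x ∈ eigSpan H K n := by
  induction n generalizing x with
  | zero =>
    have : x = 0 := by simpa using h
    rw [this]; exact zero_mem _
  | succ n ih =>
    have hy : H x - (n : k) • x ∈ K := sub_mem (hKH x hx) (K.smul_mem _ hx)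
    have h1 := ih (by omega) _ hy (by
      rw [pow_succ E, Module.End.mul_apply, T.E_pow, hKE x hx, map_zero, zero_add, map_smul] at h
      refine (smul_eq_zero.1 h).resolve_left ?_
      have := cast_ne_zero_of_lt (k := k) (p := p) (m := n + 1) (by omega) (by omega)
      exact_mod_cast this)
    obtain ⟨w, hw, z, hz, e1, e2, e3⟩ := eigSpan_solve H K n (n : k) h1
    have hz0 : z = 0 := e3 fun i hi => by
      intro hc
      exact cast_sub_ne_zero (k := k) (p := p) hi (by omega) (by rw [hc]; ring)
    have : x = w + (x - w) := by abel
    rw [this]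
    refine add_mem (eigSpan_mono H K (Nat.le_succ n) hw) (Submodule.subset_span ⟨?_, n, by omega, ?_⟩)
    · exact sub_mem hx (eigSpan_le _ _ _ hw)
    · rw [hz0, add_zero] at e1
      rw [map_sub, smul_sub]
      linear_combination (norm := module) e1

theorem mem_eigSpan' (T : SlTriple E H F) {p : ℕ} (hp2 : 2 < p) [CharP k p]
    (hF : F ^ (p - 1) = 0) (K : Submodule k M)
    (hKE : ∀ x ∈ K, E x = 0) (hKH : ∀ x ∈ K, H x ∈ K) (x : M) (hx : x ∈ K) :
    x ∈ eigSpan H K (p - 1) :=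
  T.mem_eigSpan (p := p) K hKE hKH _ (by omega) x hx (by simp [hF])

theorem H_ker (T : SlTriple E H F) (x : M) (hx : x ∈ LinearMap.ker E) : H x ∈ LinearMap.ker E := by
  rw [LinearMap.mem_ker] at *
  have := T.he x
  rw [hx] at this
  simpa using this.symm

/-- A weight vector in `ker E ∩ im F` vanishes. -/
theorem weight_zero (T : SlTriple E H F) {p : ℕ} (hp2 : 2 < p) [CharP k p]
    (hEn : E ^ (p - 1) = 0) (hF : F ^ (p - 1) = 0)
    {d : ℕ} (hd : d + 2 ≤ p) {x : M}
    (hE : E (F x) = 0) (hH : H (F x) = (d : k) • F x) : F x = 0 := by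
  have hc : F (H x - ((d : k) + 2) • x) = 0 := by
    have := T.hf x
    rw [hH] at this
    rw [map_sub, map_smul, add_smul, this]
    abel
  have hz0 := T.swap.mem_eigSpan' hp2 hEn (LinearMap.ker F) (fun _ h => h) T.swap.H_ker _ hc
  obtain ⟨w, hw, z, hz, e1, e2, -⟩ := eigSpan_solve (-H) _ _ (-((d : k) + 2)) hz0
  have hw := eigSpan_le _ _ _ hw
  replace hz : F z = 0 := eigSpan_le _ _ _ hz
  have hw' : F w = 0 := hw
  obtain ⟨y, hy⟩ : ∃ y, y = x + w := ⟨_, rfl⟩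
  have hFy : F y = F x := by rw [hy, map_add, hw', add_zero]
  rw [← hFy] at hE ⊢
  have hHy : H y = ((d : k) + 2) • y + z := by
    rw [hy, map_add, smul_add]
    simp only [LinearMap.neg_apply] at e1
    linear_combination (norm := module) e1
  clear hy hFy hH hc hz0 e1 hw hw'
  obtain ⟨d', rfl⟩ := Nat.exists_eq_add_of_le hd
  have hp : (d : k) + 2 + d' = 0 := by
    have := CharP.cast_eq_zero k (d + 2 + d')
    exact_mod_cast this
  have hHz : (-H) z = (d' : k) • z := by
    rw [e2]; congr 1; linear_combination -hp
  have hEz : (E ^ (d' + 1)) z = 0 := T.swap.F_kill (p := d + 2 + d') hEn (by omega) hz hHz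
  have key (j : ℕ) : F ((E ^ (j + 1)) y) =
      -((j : k) + 1) • (((d : k) + 2 + j) • (E ^ j) y + (E ^ j) z) := by
    rw [T.F_pow, hHy, pow_succ, Module.End.mul_apply, hE]
    simp only [map_add, map_smul, map_zero]
    module
  have h3 (m : ℕ) (hm : m ≤ d) : (E ^ (d' + 1 + (d - m))) y = 0 := by
    induction m with
    | zero =>
      rw [show d' + 1 + (d - 0) = d + 2 + d' - 1 by omega, hEn]; simp
    | succ m ih =>
      have ih := ih (by omega)
      obtain ⟨q, hq⟩ : ∃ q, d - m = q + 1 := ⟨d - m - 1, by omega⟩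
      have hq' : d - (m + 1) = q := by omega
      rw [hq, ← add_assoc] at ih
      have := key (d' + 1 + q)
      have hEz' : (E ^ (d' + 1 + q)) z = 0 := by
        rw [add_comm, pow_add, Module.End.mul_apply, hEz, map_zero]
      rw [ih, map_zero, hEz', add_zero, smul_smul] at this
      rw [hq']
      refine (smul_eq_zero.1 this.symm).resolve_left (mul_ne_zero (neg_ne_zero.2 ?_) ?_)
      · have := cast_ne_zero_of_lt (k := k) (p := d + 2 + d') (m := d' + 1 + q + 1)
          (by omega) (by omega)
        exact_mod_cast this
      · have := cast_ne_zero_of_lt (k := k) (p := d + 2 + d') (m := q + 1)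
          (by omega) (by omega)
        push_cast at this ⊢
        intro h
        apply this
        linear_combination h - hp
  have h4 : (E ^ (d' + 1)) y = 0 := by simpa using h3 d le_rfl
  have hz0 : z = 0 := by
    apply T.swap.inj (p := d + 2 + d') (by omega) hz hHz d' le_rfl
    have := key d'
    rw [h4, map_zero, hp, zero_smul, zero_add] at this
    refine (smul_eq_zero.1 this.symm).resolve_left (neg_ne_zero.2 ?_)
    have := cast_ne_zero_of_lt (k := k) (p := d + 2 + d') (m := d' + 1)
      (by omega) (by omega)
    exact_mod_cast this
  subst hz0
  have h5 : (F ^ (d' + 1)) ((E ^ d') y) = 0 := by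
    apply T.F_kill (p := d + 2 + d') hF (by omega)
    · rw [← Module.End.mul_apply, ← pow_succ', h4]
    · have hy2 : (-H) y = (-((d : k) + 2)) • y := by
        rw [LinearMap.neg_apply, hHy]; module
      have := T.swap.H_string hy2 d'
      rw [LinearMap.neg_apply, neg_eq_iff_eq_neg, ← neg_smul] at this
      rw [this]
      congr 1
      linear_combination hp
  have h6 (j : ℕ) (hj : j ≤ d') (h : (F ^ (j + 1)) ((E ^ j) y) = 0) : F y = 0 := by
    induction j with
    | zero => simpa using h
    | succ j ih =>
      apply ih (by omega)
      rw [pow_succ, Module.End.mul_apply, key, map_zero, add_zero, smul_smul, map_smul] at h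
      refine (smul_eq_zero.1 h).resolve_left (mul_ne_zero (neg_ne_zero.2 ?_) ?_)
      · have := cast_ne_zero_of_lt (k := k) (p := d + 2 + d') (m := j + 1)
          (by omega) (by omega)
        exact_mod_cast this
      · have := cast_ne_zero_of_lt (k := k) (p := d + 2 + d') (m := d + 2 + j)
          (by omega) (by omega)
        exact_mod_cast this
  exact h6 d' le_rfl h5

theorem disj (T : SlTriple E H F) {p : ℕ} (hp2 : 2 < p) [CharP k p]
    (hEn : E ^ (p - 1) = 0) (hF : F ^ (p - 1) = 0) :
    LinearMap.ker E ⊓ LinearMap.range F = ⊥ := by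
  rw [eq_bot_iff]
  intro v hv
  have h := T.mem_eigSpan' hp2 hF (LinearMap.ker E ⊓ LinearMap.range F) (fun x h => h.1)
    (by
      rintro _ ⟨h1, x, rfl⟩
      refine ⟨T.H_ker _ h1, H x - (2 : k) • x, ?_⟩
      rw [T.hf, map_sub, map_smul]) v hv
  have hle : eigSpan H (LinearMap.ker E ⊓ LinearMap.range F) (p - 1) ≤ ⊥ := by
    refine Submodule.span_le.2 ?_
    rintro _ ⟨⟨h1, x, rfl⟩, i, hi, h2⟩
    exact T.weight_zero hp2 hEn hF (d := i) (by omega) h1 h2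
  exact hle h

theorem sup_top (T : SlTriple E H F) [Module.Finite k M] {p : ℕ} (hp2 : 2 < p) [CharP k p]
    (hEn : E ^ (p - 1) = 0) (hF : F ^ (p - 1) = 0) :
    LinearMap.ker E ⊔ LinearMap.range F = ⊤ := by
  have a1 := Submodule.finrank_sup_add_finrank_inf_eq (LinearMap.ker E) (LinearMap.range F)
  have a2 := Submodule.finrank_sup_add_finrank_inf_eq (LinearMap.ker F) (LinearMap.range E)
  rw [T.disj hp2 hEn hF, finrank_bot] at a1
  rw [T.swap.disj hp2 hF hEn, finrank_bot] at a2
  have b1 := LinearMap.finrank_range_add_finrank_ker E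
  have b2 := LinearMap.finrank_range_add_finrank_ker F
  have c1 := Submodule.finrank_le (LinearMap.ker E ⊔ LinearMap.range F)
  have c2 := Submodule.finrank_le (LinearMap.ker F ⊔ LinearMap.range E)
  apply Submodule.eq_top_of_finrank_eq
  omega

/-- Basis of `ker E` made of weight vectors. -/
theorem exists_basis (T : SlTriple E H F) [Module.Finite k M] {p : ℕ} (hp2 : 2 < p) [CharP k p]
    (hF : F ^ (p - 1) = 0) :
    ∃ (s : ℕ) (v : Fin s → M) (d : Fin s → ℕ), LinearIndependent k v ∧
      Submodule.span k (Set.range v) = LinearMap.ker E ∧ (∀ i, d i + 2 ≤ p) ∧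
      ∀ i, H (v i) = (d i : k) • v i := by
  obtain ⟨b, hb, hs, hl⟩ := exists_linearIndependent k
    {u | u ∈ LinearMap.ker E ∧ ∃ i < p - 1, H u = (i : k) • u}
  have hfin : Finite b := hl.finite
  have hk : Submodule.span k b = LinearMap.ker E := by
    rw [hs]
    apply le_antisymm
    · exact eigSpan_le H (LinearMap.ker E) (p - 1)
    · exact fun x hx => T.mem_eigSpan' hp2 hF (LinearMap.ker E) (fun _ h => h) T.H_ker x hx
  obtain ⟨s, ⟨e⟩⟩ := Finite.exists_equiv_fin b
  have hex (i : Fin s) : ∃ d : ℕ, d + 2 ≤ p ∧ H (e.symm i : M) = (d : k) • (e.symm i : M) := by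
    obtain ⟨-, d, hd, h⟩ := hb (e.symm i).2
    exact ⟨d, by omega, h⟩
  choose d hd hHd using hex
  refine ⟨s, fun i => (e.symm i : M), d, ?_, ?_, hd, hHd⟩
  · exact hl.comp _ e.symm.injective
  · rw [← hk]
    congr 1
    ext x
    constructor
    · rintro ⟨i, rfl⟩; exact (e.symm i).2
    · intro hx; exact ⟨e ⟨x, hx⟩, by simp⟩

end SlTriple

/-- An `E`-stable subspace meeting `ker E` trivially is zero when `E` is nilpotent. -/
theorem eq_bot_of_nilp {n : ℕ} (hE : E ^ n = 0) (I : Submodule k M)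
    (hI : ∀ x ∈ I, E x ∈ I) (h0 : ∀ x ∈ I, E x = 0 → x = 0) : I = ⊥ := by
  rw [eq_bot_iff]
  intro x hx
  have (m : ℕ) : ∀ x ∈ I, (E ^ m) x = 0 → x = 0 := by
    induction m with
    | zero => intro x _ h; simpa using h
    | succ m ih =>
      intro x hx h
      rw [pow_succ, Module.End.mul_apply] at h
      exact h0 x hx (ih _ (hI x hx) h)
  exact this n x hx (by simp [hE])

end Helpers

/-- Let `k` be algebraically closed of characteristic `p > 2` and let
`M` be a finite-dimensional `sl₂(k)`-module on which `e^{p-1}` and `f^{p-1}` act as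
zero.  Then `M` is semisimple: it is an (internal) direct sum of submodules each
isomorphic to one of the simple modules `V(0), ..., V(p-2)` (i.e. each carries a
basis realizing the standard highest weight `d` action for some `d ≤ p-2`).

A representation of `sl₂(k)` is a triple of endomorphisms `E, H, F` satisfying the
commutator relations. -/
theorem semisimple_of_nilpotent_order_p_sub_one
    (k : Type*) [Field k] [IsAlgClosed k] (p : ℕ) (hp : p.Prime) (hp2 : 2 < p)
    [CharP k p]
    (M : Type*) [AddCommGroup M] [Module k M] [Module.Finite k M]
    (E H F : Module.End k M)
    (hHE : ⁅H, E⁆ = (2 : k) • E) (hHF : ⁅H, F⁆ = (-2 : k) • F) (hEF : ⁅E, F⁆ = H)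
    (hEnil : E ^ (p - 1) = 0) (hFnil : F ^ (p - 1) = 0) :
    ∃ (s : ℕ) (N : Fin s → Submodule k M),
      -- the `N i` are submodules (invariant subspaces):
      (∀ i, ∀ x ∈ N i, E x ∈ N i) ∧ (∀ i, ∀ x ∈ N i, H x ∈ N i) ∧
      (∀ i, ∀ x ∈ N i, F x ∈ N i) ∧
      -- `M` is their internal direct sum:
      (⨆ i, N i) = ⊤ ∧ (∀ i, N i ⊓ (⨆ j ∈ {j | j ≠ i}, N j) = ⊥) ∧
      -- each `N i` is isomorphic to some `V(d)` with `0 ≤ d ≤ p-2`: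
      (∀ i, ∃ d : ℕ, d ≤ p - 2 ∧ ∃ w : Fin (d + 1) → M,
        (∀ j, w j ∈ N i) ∧ LinearIndependent k w ∧
        Submodule.span k (Set.range w) = N i ∧
        (∀ j : Fin (d + 1), H (w j) = ((d : k) - 2 * ((j : ℕ) : k)) • w j) ∧
        (∀ j : Fin (d + 1),
          E (w j) = (((j : ℕ) : k) * ((d : k) - ((j : ℕ) : k) + 1)) •
            w ⟨(j : ℕ) - 1, Nat.lt_of_le_of_lt (Nat.sub_le _ _) j.isLt⟩) ∧
        (∀ j : Fin (d + 1),
          F (w j) = if h : (j : ℕ) + 1 < d + 1 then w ⟨(j : ℕ) + 1, h⟩ else 0)) := by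
  have T : SlTriple E H F := by
    refine ⟨fun x => ?_, fun x => ?_, fun x => ?_⟩
    · have := LinearMap.congr_fun hHE x
      simp only [Ring.lie_def, LinearMap.sub_apply, Module.End.mul_apply,
        LinearMap.smul_apply] at this
      linear_combination (norm := module) this
    · have := LinearMap.congr_fun hHF x
      simp only [Ring.lie_def, LinearMap.sub_apply, Module.End.mul_apply,
        LinearMap.smul_apply] at this
      rw [sub_eq_iff_eq_add.1 this]
      module
    · have := LinearMap.congr_fun hEF x
      simp only [Ring.lie_def, LinearMap.sub_apply, Module.End.mul_apply] at this
      linear_combination (norm := module) this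
  obtain ⟨s, v, d, hvl, hvs, hd, hvH⟩ := T.exists_basis hp2 hFnil
  have hvE (i) : E (v i) = 0 := by
    have : v i ∈ LinearMap.ker E := hvs ▸ Submodule.subset_span ⟨i, rfl⟩
    exact this
  let w (i : Fin s) (j : Fin (d i + 1)) : M := (F ^ (j : ℕ)) (v i)
  let N (i : Fin s) : Submodule k M := Submodule.span k (Set.range (w i))
  have hwH (i) (j : Fin (d i + 1)) :
      H (w i j) = ((d i : k) - 2 * ((j : ℕ) : k)) • w i j := T.H_string (hvH i) j
  have hwE (i) (j : Fin (d i + 1)) :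
      E (w i j) = (((j : ℕ) : k) * ((d i : k) - ((j : ℕ) : k) + 1)) •
            w i ⟨(j : ℕ) - 1, Nat.lt_of_le_of_lt (Nat.sub_le _ _) j.isLt⟩ := by
    obtain ⟨j, hj⟩ := j
    cases j with
    | zero => simp [w, hvE]
    | succ j =>
      simp only [w, Nat.add_sub_cancel]
      rw [T.E_string (hvE i) (hvH i) j]
      congr 1
      push_cast
      ring
  have hwF (i) (j : Fin (d i + 1)) :
      F (w i j) = if h : (j : ℕ) + 1 < d i + 1 then w i ⟨(j : ℕ) + 1, h⟩ else 0 := by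
    split_ifs with h
    · simp only [w, pow_succ', Module.End.mul_apply]
    · have hj : (j : ℕ) = d i := by omega
      simp only [w]
      rw [← Module.End.mul_apply, ← pow_succ', hj]
      exact T.F_kill hFnil (hd i) (hvE i) (hvH i)
  have hwN (i) (j) : w i j ∈ N i := Submodule.subset_span ⟨j, rfl⟩
  have stab (G : Module.End k M) (hG : ∀ i j, G (w i j) ∈ N i) (i) : ∀ x ∈ N i, G x ∈ N i := by
    have : N i ≤ (N i).comap G := by
      refine Submodule.span_le.2 ?_
      rintro _ ⟨j, rfl⟩
      exact hG i j
    exact this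
  have hNE := stab E fun i j => by rw [hwE]; exact Submodule.smul_mem _ _ (hwN _ _)
  have hNH := stab H fun i j => by rw [hwH]; exact Submodule.smul_mem _ _ (hwN _ _)
  have hNF := stab F fun i j => by
    rw [hwF]
    split_ifs
    · exact hwN _ _
    · exact zero_mem _
  have hvN (i) : v i ∈ N i := by simpa [w] using hwN i 0
  have hsup (t : Set (Fin s)) (G : Module.End k M) (hG : ∀ i, ∀ x ∈ N i, G x ∈ N i) :
      ∀ x ∈ ⨆ j ∈ t, N j, G x ∈ ⨆ j ∈ t, N j := by
    have : ⨆ j ∈ t, N j ≤ (⨆ j ∈ t, N j).comap G := by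
      refine iSup₂_le fun j hj x hx => ?_
      exact (le_iSup₂ (f := fun j (_ : j ∈ t) => N j) j hj) (hG j x hx)
    exact this
  have hNle (i) : N i ≤ Submodule.span k {v i} ⊔ LinearMap.range F := by
    refine Submodule.span_le.2 ?_
    rintro _ ⟨⟨j, hj⟩, rfl⟩
    cases j with
    | zero =>
      refine Submodule.mem_sup_left ?_
      simp [w, Submodule.mem_span_singleton_self]
    | succ j =>
      refine Submodule.mem_sup_right ?_
      simp only [w, pow_succ', Module.End.mul_apply]
      exact ⟨_, rfl⟩
  have hkerle (t : Set (Fin s)) (x : M) (hx : x ∈ ⨆ j ∈ t, N j) (hE : E x = 0) :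
      x ∈ Submodule.span k (v '' t) := by
    have h1 : ⨆ j ∈ t, N j ≤ Submodule.span k (v '' t) ⊔ LinearMap.range F := by
      refine iSup₂_le fun j hj => (hNle j).trans (sup_le_sup_right ?_ _)
      exact Submodule.span_mono (Set.singleton_subset_iff.2 ⟨j, hj, rfl⟩)
    obtain ⟨a, ha, b, hb, hab⟩ := Submodule.mem_sup.1 (h1 hx)
    have haE : E a = 0 := by
      have : Submodule.span k (v '' t) ≤ LinearMap.ker E := by
        rw [← hvs]; exact Submodule.span_mono (Set.image_subset_range _ _)
      exact this ha
    have hbE : E b = 0 := by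
      rw [← hab, map_add, haE, zero_add] at hE; exact hE
    have hb0 : b ∈ (⊥ : Submodule k M) := T.disj hp2 hEnil hFnil ▸ ⟨hbE, hb⟩
    rw [Submodule.mem_bot] at hb0
    rw [← hab, hb0, add_zero]; exact ha
  refine ⟨s, N, hNE, hNH, hNF, ?_, ?_, ?_⟩
  · have hkS : LinearMap.ker E ≤ ⨆ i, N i := by
      rw [← hvs]
      refine Submodule.span_le.2 ?_
      rintro _ ⟨i, rfl⟩
      exact le_iSup N i (hvN i)
    have hFS : ∀ x ∈ ⨆ i, N i, F x ∈ ⨆ i, N i := by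
      simpa using hsup Set.univ F hNF
    have hstep (n : ℕ) : ∀ x, ∃ y ∈ ⨆ i, N i, ∃ z, x = y + (F ^ n) z := by
      induction n with
      | zero => intro x; exact ⟨0, zero_mem _, x, by simp⟩
      | succ n ih =>
        intro x
        have hx : x ∈ LinearMap.ker E ⊔ LinearMap.range F := by
          rw [T.sup_top hp2 hEnil hFnil]; trivial
        obtain ⟨a, ha, _, ⟨b, rfl⟩, rfl⟩ := Submodule.mem_sup.1 hx
        obtain ⟨y, hy, z, rfl⟩ := ih b
        refine ⟨a + F y, add_mem (hkS ha) (hFS y hy), z, ?_⟩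
        rw [map_add, pow_succ', Module.End.mul_apply, add_assoc]
    rw [eq_top_iff]
    intro x _
    obtain ⟨y, hy, z, rfl⟩ := hstep (p - 1) x
    simpa [hFnil] using hy
  · intro i
    refine eq_bot_of_nilp hEnil _ ?_ ?_
    · rintro x ⟨h1, h2⟩
      exact ⟨hNE i x h1, hsup _ E hNE x h2⟩
    · rintro x ⟨h1, h2⟩ hE
      have a1 := hkerle {i} x (by simpa using h1) hE
      have a2 := hkerle _ x h2 hE
      have hdis : Disjoint ({i} : Set (Fin s)) {j | j ≠ i} := by
        rw [Set.disjoint_singleton_left]; simp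
      exact Submodule.disjoint_def.1 (hvl.disjoint_span_image hdis) x a1 a2
  · intro i
    refine ⟨d i, by have := hd i; omega, w i, hwN i, ?_, rfl, hwH i, hwE i, hwF i⟩
    refine Module.End.eigenvectors_linearIndependent' H
      (fun j : Fin (d i + 1) => (d i : k) - 2 * ((j : ℕ) : k)) ?_ (w i) ?_
    · have h2 : (2 : k) ≠ 0 := by
        exact_mod_cast cast_ne_zero_of_lt (k := k) (p := p) (m := 2) (by omega) hp2
      intro a b hab
      have hab' : ((a : ℕ) : k) = ((b : ℕ) : k) := by
        have : (2 : k) * ((a : ℕ) : k) = 2 * ((b : ℕ) : k) := by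
          simp only at hab
          linear_combination -hab
        exact mul_left_cancel₀ h2 this
      have hdi := hd i
      rcases lt_trichotomy (a : ℕ) b with h | h | h
      · exact absurd (by rw [hab', sub_self]) (cast_sub_ne_zero (k := k) (p := p) h (by omega))
      · exact Fin.ext h
      · exact absurd (by rw [hab', sub_self]) (cast_sub_ne_zero (k := k) (p := p) h (by omega))
    · intro j
      refine ⟨Module.End.mem_eigenspace_iff.2 (hwH i j), fun h => hvl.ne_zero i ?_⟩
      have hdi := hd i
      exact T.inj (p := p) (by omega) (hvE i) (hvH i) j (by omega) h
end

section
/- Let k be an algebraically closed field of characteristic p > 2, let G = GL_n(k), and let N^{p-1} = { x ∈ gl_n(k) : x nilpotent, x^{p-1} = 0 }. Then for every nilpotent e ∈ gl_n(k) with e^{p-1} = 0 there exist h, f ∈ gl_n(k) with f^{p-1} = 0 such that (e, h, f) is an sl_2-triple, and any two sl_2-triples (e, h, f), (e, h', f') with f^{p-1} = (f')^{p-1} = 0 are conjugate by an element of GL_n(k) fixing e. -/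
open Polynomial

structure NTri {k V : Type*} [Field k] [AddCommGroup V] [Module k V] (p : ℕ)
    (e h f : Module.End k V) : Prop where
  he : ∀ v, h (e v) = e (h v) + (2:k) • e v
  hf : ∀ v, h (f v) = f (h v) - (2:k) • f v
  ef : ∀ v, e (f v) = f (e v) + h v
  ep : e ^ (p-1) = 0
  fp : f ^ (p-1) = 0

namespace NTri
variable {k V : Type*} [Field k] [AddCommGroup V] [Module k V] {p : ℕ}
  {e h f : Module.End k V}

theorem hfpow (T : NTri p e h f) (m : ℕ) (v : V) :
    h ((f^m) v) = (f^m) (h v) - (2*m:k) • (f^m) v := by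
  induction m with
  | zero => simp
  | succ m ih =>
    simp only [pow_succ', Module.End.mul_apply, T.hf, ih, map_sub, map_smul]
    push_cast; module

theorem hepow (T : NTri p e h f) (m : ℕ) (v : V) :
    h ((e^m) v) = (e^m) (h v) + (2*m:k) • (e^m) v := by
  induction m with
  | zero => simp
  | succ m ih =>
    simp only [pow_succ', Module.End.mul_apply, T.he, ih, map_add, map_smul]
    push_cast; module

theorem efpow (T : NTri p e h f) (m : ℕ) (v : V) :
    e ((f^(m+1)) v) = (f^(m+1)) (e v) + ((m+1):k) • ((f^m) (h v) - (m:k) • (f^m) v) := by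
  induction m with
  | zero => simp [T.ef]
  | succ m ih =>
    rw [pow_succ' f (m+1), Module.End.mul_apply, T.ef, ih, T.hfpow]
    simp only [pow_succ', Module.End.mul_apply, map_add, map_sub, map_smul]
    push_cast; module

theorem epowf (T : NTri p e h f) (m : ℕ) (v : V) :
    (e^(m+1)) (f v) = f ((e^(m+1)) v) + ((m+1):k) • (h ((e^m) v) - (m:k) • (e^m) v) := by
  induction m with
  | zero => simp [T.ef]
  | succ m ih =>
    rw [pow_succ' e (m+1), Module.End.mul_apply, ih]
    simp only [pow_succ', Module.End.mul_apply, map_add, map_sub, map_smul, T.ef, T.he]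
    push_cast; module

/-- constants -/
def cc (k : Type*) [Field k] (i m : ℕ) : k := ∏ l ∈ Finset.range m, ((l+1:k) * ((i:k) - l))

theorem cast_ne (_hp : p.Prime) [CharP k p] {t : ℕ} (h0 : 0 < t) (h1 : t < p) : (t:k) ≠ 0 := by
  rw [Ne, CharP.cast_eq_zero_iff k p]
  exact Nat.not_dvd_of_pos_of_lt h0 h1

theorem cc_ne (hp : p.Prime) [CharP k p] {i m : ℕ} (hm : m ≤ i) (hi : i < p - 1) :
    cc k i m ≠ 0 := by
  refine Finset.prod_ne_zero_iff.2 fun l hl => ?_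
  have hl' := Finset.mem_range.1 hl
  refine mul_ne_zero ?_ ?_
  · have := cast_ne (k := k) hp (t := l+1) (by omega) (by omega)
    simpa using this
  · have := cast_ne (k := k) hp (t := i-l) (by omega) (by omega)
    rwa [Nat.cast_sub (by omega)] at this

theorem epfp (T : NTri p e h f) {i : ℕ} {u : V} (hu : e u = 0) (hw : h u = (i:k) • u) (m : ℕ) :
    (e^m) ((f^m) u) = cc k i m • u := by
  induction m with
  | zero => simp [cc]
  | succ m ih =>
    rw [pow_succ e, Module.End.mul_apply, T.efpow, hu, hw]
    simp only [map_zero, zero_add, map_smul, map_sub, ih]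
    have : cc k i (m+1) = cc k i m * ((m+1:k) * ((i:k) - m)) := Finset.prod_range_succ _ _
    rw [this]
    module

theorem epfp_nodal (T : NTri p e h f) (m : ℕ) {v : V} (hv : e v = 0) :
    (e^m) ((f^m) v) = (m.factorial : k) •
      aeval h (Lagrange.nodal (Finset.range m) (fun i : ℕ => (i:k))) v := by
  induction m generalizing v with
  | zero => simp
  | succ m ih =>
    rw [pow_succ e, Module.End.mul_apply, T.efpow, hv]
    have h1 : e (h v - (m:k) • v) = 0 := by
      have := T.he v
      rw [hv] at this
      simp at this
      simp [hv, ← this]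
    have := ih h1
    simp only [map_zero, zero_add, map_smul, map_sub] at this ⊢
    have h2 : Lagrange.nodal (Finset.range (m+1)) (fun i : ℕ => (i:k)) =
        Lagrange.nodal (Finset.range m) (fun i : ℕ => (i:k)) * (X - C (m:k)) :=
      Finset.prod_range_succ _ _
    rw [this, h2, Nat.factorial_succ]
    simp only [map_mul, Module.End.mul_apply, map_sub, aeval_X, aeval_C, LinearMap.sub_apply,
      Module.algebraMap_end_apply, map_smul]
    push_cast; module

theorem nodal_zero (T : NTri p e h f) (hp : p.Prime) [CharP k p] {v : V} (hv : e v = 0) :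
    aeval h (Lagrange.nodal (Finset.range (p-1)) (fun i : ℕ => (i:k))) v = 0 := by
  have := T.epfp_nodal (p-1) hv
  rw [T.fp] at this
  simp only [LinearMap.zero_apply, map_zero] at this
  refine (smul_eq_zero.1 this.symm).resolve_left ?_
  intro h0
  rw [CharP.cast_eq_zero_iff k p, hp.dvd_factorial] at h0
  have := hp.pos
  omega

theorem key (T : NTri p e h f) (hp : p.Prime) [CharP k p] {i : ℕ} (hi : i < p - 1) {v : V}
    (hu : e ((e^(i+1)) v) = 0) (hw : h ((e^(i+1)) v) = (i:k) • (e^(i+1)) v) :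
    (e^(i+1)) v = 0 := by
  set u := (e^(i+1)) v with hu'
  have main : ∀ m, m ≤ p - 2 - i → ∃ c : k, c ≠ 0 ∧ (e^(i+1+m)) ((f^m) v) = c • u := by
    intro m
    induction m with
    | zero => intro _; exact ⟨1, one_ne_zero, by simp [hu']⟩
    | succ m ih =>
      intro hm
      obtain ⟨c, hc, hcu⟩ := ih (by omega)
      refine ⟨-((m+1:ℕ):k) * ((i+1+(m+1):ℕ):k) * c, ?_, ?_⟩
      · have h1 := cast_ne (k := k) hp (t := m+1) (by omega) (by omega)
        have h2 := cast_ne (k := k) hp (t := i+1+(m+1)) (by omega) (by omega)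
        exact mul_ne_zero (mul_ne_zero (neg_ne_zero.2 h1) h2) hc
      · rw [pow_succ' f, Module.End.mul_apply, ← add_assoc, T.epowf, pow_succ' e,
          Module.End.mul_apply, hcu]
        simp only [map_smul, hu, hw, smul_zero, map_zero, zero_add]
        push_cast; module
  obtain ⟨c, hc, hcu⟩ := main (p-2-i) le_rfl
  rw [show i+1+(p-2-i) = p-1 by omega, T.ep] at hcu
  exact (smul_eq_zero.1 hcu.symm).resolve_left hc

theorem fkill (T : NTri p e h f) (hp : p.Prime) [CharP k p] {i : ℕ} (hi : i < p - 1) {u : V}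
    (hu : e u = 0) (hw : h u = (i:k) • u) : (f^(i+1)) u = 0 := by
  have h1 : e ((f^(i+1)) u) = 0 := by
    rw [T.efpow, hu, hw]; simp
  have h2 : h ((f^(i+1)) u) = ((p-2-i : ℕ):k) • (f^(i+1)) u := by
    rw [T.hfpow, hw, Nat.cast_sub (by omega), Nat.cast_sub (by omega), CharP.cast_eq_zero k p]
    simp only [map_smul]
    push_cast; module
  have h3 := T.epfp h1 h2 (p-2-i)
  rw [← Module.End.mul_apply (f^(p-2-i)), ← pow_add, show p-2-i+(i+1) = p-1 by omega, T.fp] at h3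
  simp only [LinearMap.zero_apply, map_zero] at h3
  exact (smul_eq_zero.1 h3.symm).resolve_left (cc_ne hp le_rfl (by omega))

theorem epfp_gt (T : NTri p e h f) {i : ℕ} {u : V} (hu : e u = 0) (hw : h u = (i:k) • u)
    {m j : ℕ} (hj : j < m) : (e^m) ((f^j) u) = 0 := by
  obtain ⟨r, rfl⟩ := Nat.exists_eq_add_of_lt hj
  rw [show j + r + 1 = r + 1 + j by omega, pow_add, Module.End.mul_apply, T.epfp hu hw, map_smul,
    pow_succ, Module.End.mul_apply, hu]
  simp

theorem mem_range (T : NTri p e h f) (hp : p.Prime) [CharP k p] {i j : ℕ} (hi : i < p - 1)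
    (hj : j ≤ i) {u : V}
    (hu : e u = 0) (hw : h u = (i:k) • u) : u ∈ LinearMap.range (e^j) := by
  refine ⟨(cc k i j)⁻¹ • (f^j) u, ?_⟩
  rw [map_smul, T.epfp hu hw, smul_smul, inv_mul_cancel₀ (cc_ne hp hj hi), one_smul]

/-- projections -/
noncomputable def pr (p : ℕ) (h : Module.End k V) (i : ℕ) : Module.End k V :=
  aeval h (Lagrange.basis (Finset.range (p-1)) (fun i : ℕ => (i:k)) i)

theorem injOn (hp : p.Prime) [CharP k p] :
    Set.InjOn (fun i : ℕ => (i:k)) (Finset.range (p-1) : Set ℕ) := by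
  intro a ha b hb hab
  simp only [Finset.coe_range, Set.mem_Iio] at ha hb
  have := (CharP.natCast_eq_natCast k p).1 hab
  exact Nat.ModEq.eq_of_lt_of_lt this (by omega) (by omega)

theorem sum_pr (hp : p.Prime) (hp2 : 2 < p) [CharP k p] (h : Module.End k V) (v : V) :
    ∑ i ∈ Finset.range (p-1), pr p h i v = v := by
  have := Lagrange.sum_basis (injOn (k := k) hp) (by simp; omega)
  have h2 := congrArg (fun q => aeval h q v) this
  simpa [map_sum, LinearMap.sum_apply, pr] using h2

theorem inv_aeval {W : Submodule k V} (hW : ∀ v ∈ W, h v ∈ W) (q : k[X]) :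
    ∀ v ∈ W, aeval h q v ∈ W := by
  intro v hv
  induction q using Polynomial.induction_on' with
  | add a b ha hb => simpa using W.add_mem ha hb
  | monomial n a =>
    simp only [aeval_monomial, Module.End.mul_apply, Module.algebraMap_end_apply]
    refine W.smul_mem _ ?_
    induction n with
    | zero => simpa
    | succ n ih => rw [pow_succ', Module.End.mul_apply]; exact hW _ ih

theorem pr_eig {i j : ℕ} (hp : p.Prime) [CharP k p] (hi : i < p - 1) (hj : j < p - 1) {u : V}
    (hw : h u = (i:k) • u) : pr p h j u = if i = j then u else 0 := by
  have h1 : ∀ q : k[X], aeval h q u = (q.eval (i:k)) • u := by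
    intro q
    induction q using Polynomial.induction_on' with
    | add a b ha hb => simp [ha, hb, add_smul]
    | monomial n a =>
      simp only [aeval_monomial, Module.End.mul_apply, Module.algebraMap_end_apply, eval_monomial,
        mul_smul]
      congr 1
      induction n with
      | zero => simp
      | succ n ih =>
        rw [pow_succ', Module.End.mul_apply, ih, map_smul, hw, smul_smul, pow_succ]
  rw [pr, h1]
  split_ifs with hij
  · subst hij
    rw [Lagrange.eval_basis_self (injOn hp) (by simpa using hi), one_smul]
  · rw [Lagrange.eval_basis_of_ne (v := fun i : ℕ => (i:k)) (Ne.symm hij) (by simpa using hi), zero_smul]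

theorem h_ker (T : NTri p e h f) : ∀ v ∈ LinearMap.ker e, h v ∈ LinearMap.ker e := by
  intro v hv
  rw [LinearMap.mem_ker] at *
  have := T.he v
  rw [hv] at this
  simpa using this.symm

theorem h_range (T : NTri p e h f) (m : ℕ) :
    ∀ v ∈ LinearMap.range (e^m), h v ∈ LinearMap.range (e^m) := by
  rintro _ ⟨v, rfl⟩
  exact ⟨h v + (2*m:k) • v, by rw [T.hepow]; simp⟩

theorem pr_ker (T : NTri p e h f) {v : V} (hv : e v = 0) (i : ℕ) : e (pr p h i v) = 0 :=
  inv_aeval T.h_ker _ v hv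

theorem pr_wt (T : NTri p e h f) (hp : p.Prime) [CharP k p] {v : V} (hv : e v = 0) {i : ℕ}
    (hi : i < p - 1) : h (pr p h i v) = (i:k) • pr p h i v := by
  have h1 := T.nodal_zero hp hv
  rw [Lagrange.nodal_eq_mul_nodal_erase (i := i) (by simpa using hi)] at h1
  rw [← sub_eq_zero, pr, Lagrange.basis_eq_prod_sub_inv_mul_nodal_div (by simpa using hi),
    ← Lagrange.nodal_erase_eq_nodal_div (by simpa using hi)]
  simp only [map_mul, Module.End.mul_apply, map_sub, aeval_X, aeval_C, LinearMap.sub_apply,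
      Module.algebraMap_end_apply, map_smul] at h1 ⊢
  rw [smul_comm, ← smul_sub, h1, smul_zero]

theorem pr_lt (T : NTri p e h f) (hp : p.Prime) [CharP k p] {v : V} (hv : e v = 0) {i m : ℕ}
    (hi : i < p - 1) (him : i < m) (hm : v ∈ LinearMap.range (e^m)) : pr p h i v = 0 := by
  have h1 := T.pr_wt hp hv hi
  have h2 := T.pr_ker hv i
  obtain ⟨y, hy⟩ := inv_aeval (T.h_range m) _ v hm
  change _ = pr p h i v at hy
  rw [show m = i+1+(m-i-1) by omega, pow_add, Module.End.mul_apply] at hy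
  rw [← hy] at h1 h2 ⊢
  exact T.key hp hi h2 h1

theorem span_top (T : NTri p e h f) (hp : p.Prime) (hp2 : 2 < p) [CharP k p] (W : Submodule k V)
    (hW : ∀ i j u, i < p - 1 → j ≤ i → e u = 0 → h u = (i:k) • u → (f^j) u ∈ W) (v : V) :
    v ∈ W := by
  have main : ∀ m, ∀ v, (e^m) v = 0 → v ∈ W := by
    intro m
    induction m with
    | zero => intro v hv; simp at hv; simp [hv]
    | succ m ih =>
      intro v hv
      set x := (e^m) v with hx
      have hx0 : e x = 0 := by rw [hx, ← Module.End.mul_apply, ← pow_succ', hv]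
      let w : V := ∑ j ∈ Finset.range (p-1), if m ≤ j then (cc k j m)⁻¹ • (f^m) (pr p h j x) else 0
      have hw : w ∈ W := by
        refine W.sum_mem fun j hj => ?_
        have hj := Finset.mem_range.1 hj
        split_ifs with hmj
        · exact W.smul_mem _ (hW j m _ hj hmj (T.pr_ker hx0 j) (T.pr_wt hp hx0 hj))
        · exact W.zero_mem
      have h1 : (e^m) w = x := by
        refine Eq.trans ?_ (sum_pr hp hp2 h x)
        rw [map_sum]
        refine Finset.sum_congr rfl fun j hj => ?_
        have hj := Finset.mem_range.1 hj
        split_ifs with hmj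
        · rw [map_smul, T.epfp (T.pr_ker hx0 j) (T.pr_wt hp hx0 hj), smul_smul,
            inv_mul_cancel₀ (cc_ne hp hmj hj), one_smul]
        · rw [T.pr_lt hp hx0 hj (not_le.1 hmj) ⟨v, hx.symm⟩, map_zero]
      have := W.add_mem (ih (v - w) (by rw [map_sub, h1, hx, sub_self])) hw
      simpa using this
  exact main (p-1) v (by rw [T.ep]; rfl)

/-- highest weight space -/
def K (e h : Module.End k V) (i : ℕ) : Submodule k V :=
  LinearMap.ker e ⊓ LinearMap.ker (h - (i:k) • (1 : Module.End k V))

theorem mem_K {i : ℕ} {u : V} : u ∈ K e h i ↔ e u = 0 ∧ h u = (i:k) • u := by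
  simp [K, sub_eq_zero]

theorem inj (T : NTri p e h f) (hp : p.Prime) [CharP k p] (w : ℕ → ℕ → V)
    (hw : ∀ i j, w i j ∈ K e h i)
    (h0 : ∑ i ∈ Finset.range (p-1), ∑ j ∈ Finset.range (p-1), (f^j) (w i j) = 0) :
    ∀ i < p - 1, ∀ j ≤ i, w i j = 0 := by
  have hfk : ∀ i < p-1, ∀ j, i < j → (f^j) (w i j) = 0 := by
    intro i hi j hij
    obtain ⟨a, b⟩ := mem_K.1 (hw i j)
    rw [show j = (j-i-1)+(i+1) by omega, pow_add, Module.End.mul_apply,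
      show (j-i-1)+(i+1) = j by omega, T.fkill hp hi a b, map_zero]
  have main : ∀ J ≤ p - 1, ∑ i ∈ Finset.range (p-1), ∑ j ∈ Finset.range J, (f^j) (w i j) = 0 →
      ∀ i < p-1, ∀ j < J, j ≤ i → w i j = 0 := by
    intro J
    induction J with
    | zero => intro _ _ i _ j hj; omega
    | succ J ih =>
      intro hJ hs
      have h1 : ∑ i ∈ Finset.range (p-1), (e^J) ((f^J) (w i J)) = 0 := by
        have := congrArg (e^J) hs
        rw [map_zero, map_sum] at this
        rw [← this]
        refine Finset.sum_congr rfl fun i hi => ?_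
        obtain hwi := fun j => mem_K.1 (hw i j)
        rw [Finset.sum_range_succ, map_add, map_sum, Finset.sum_eq_zero, zero_add]
        intro j hj
        exact T.epfp_gt (hwi j).1 (hwi j).2 (Finset.mem_range.1 hj)
      have h2 : ∀ i < p - 1, J ≤ i → w i J = 0 := by
        intro i hi hJi
        have := congrArg (pr p h i) h1
        rw [map_zero, map_sum, Finset.sum_eq_single i] at this
        · obtain ⟨a, b⟩ := mem_K.1 (hw i J)
          rw [T.epfp a b, map_smul, pr_eig hp hi hi b, if_pos rfl] at this
          exact (smul_eq_zero.1 this).resolve_left (cc_ne hp hJi hi)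
        · intro j hj hji
          obtain ⟨a, b⟩ := mem_K.1 (hw j J)
          rw [T.epfp a b, map_smul, pr_eig hp (Finset.mem_range.1 hj) hi b, if_neg hji, smul_zero]
        · intro hni; exact absurd (Finset.mem_range.2 hi) hni
      have h3 := ih (by omega) (by
        rw [← hs]
        refine Finset.sum_congr rfl fun i hi => ?_
        have hi := Finset.mem_range.1 hi
        rw [Finset.sum_range_succ]
        by_cases hJi : J ≤ i
        · rw [h2 i hi hJi, map_zero, add_zero]
        · rw [hfk i hi J (by omega), add_zero])
      intro i hi j hj hji
      rcases Nat.lt_succ_iff_lt_or_eq.1 hj with h4 | rfl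
      · exact h3 i hi j h4 hji
      · exact h2 i hi hji
  intro i hi j hj
  exact main (p-1) le_rfl h0 i hi j (by omega) hj

theorem finrank_le [FiniteDimensional k V] {h' f' : Module.End k V} (T : NTri p e h f)
    (T' : NTri p e h' f') (hp : p.Prime) (hp2 : 2 < p) [CharP k p] {i : ℕ} (hi : i < p - 1) :
    Module.finrank k (K e h i) ≤ Module.finrank k (K e h' i) := by
  let φ : K e h i →ₗ[k] K e h' i := LinearMap.codRestrict _ (pr p h' i ∘ₗ (K e h i).subtype) (by
    intro u
    have hu := (mem_K.1 u.2).1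
    exact mem_K.2 ⟨T'.pr_ker hu i, T'.pr_wt hp hu hi⟩)
  refine LinearMap.finrank_le_finrank_of_injective (f := φ) ?_
  rw [← LinearMap.ker_eq_bot, LinearMap.ker_eq_bot']
  rintro ⟨u, hu⟩ h0
  have h0' : pr p h' i u = 0 := congrArg Subtype.val h0
  obtain ⟨a, b⟩ := mem_K.1 hu
  have h1 : u ∈ LinearMap.range (e^(i+1)) := by
    rw [← sum_pr hp hp2 h' u]
    refine Submodule.sum_mem _ fun j hj => ?_
    have hj := Finset.mem_range.1 hj
    rcases lt_trichotomy j i with hji | rfl | hji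
    · rw [T'.pr_lt hp a hj hji (T.mem_range hp hi le_rfl a b)]; exact Submodule.zero_mem _
    · rw [h0']; exact Submodule.zero_mem _
    · exact T'.mem_range hp hj hji (T'.pr_ker a j) (T'.pr_wt hp a hj)
  obtain ⟨v, rfl⟩ := h1
  exact Subtype.ext (T.key hp hi a b)

/-- the total map -/
def Phi (p : ℕ) (e h f : Module.End k V) : (∀ i : Fin (p-1), Fin (p-1) → K e h i) →ₗ[k] V :=
  ∑ i : Fin (p-1), ∑ j : Fin (p-1),
    (f^(j:ℕ)) ∘ₗ (K e h i).subtype ∘ₗ LinearMap.proj j ∘ₗ LinearMap.proj i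

theorem Phi_apply (w : ∀ i : Fin (p-1), Fin (p-1) → K e h i) :
    Phi p e h f w = ∑ i : Fin (p-1), ∑ j : Fin (p-1), (f^(j:ℕ)) (w i j : V) := by
  simp [Phi, LinearMap.sum_apply]

theorem Phi_single (i j : Fin (p-1)) (u : K e h i) :
    Phi p e h f (Pi.single i (Pi.single j u)) = (f^(j:ℕ)) (u : V) := by
  rw [Phi_apply, Finset.sum_eq_single i, Finset.sum_eq_single j]
  · simp
  · intro b _ hb; simp [hb]
  · simp
  · intro b _ hb; simp [hb]
  · simp

theorem Phi_surj (T : NTri p e h f) (hp : p.Prime) (hp2 : 2 < p) [CharP k p] :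
    Function.Surjective (Phi p e h f) := by
  intro v
  refine T.span_top hp hp2 (LinearMap.range (Phi p e h f)) ?_ v
  intro i j u hi hj a b
  exact ⟨_, Phi_single ⟨i, hi⟩ ⟨j, by omega⟩ ⟨u, mem_K.2 ⟨a, b⟩⟩⟩

theorem Phi_inj (T : NTri p e h f) (hp : p.Prime) [CharP k p]
    (w : ∀ i : Fin (p-1), Fin (p-1) → K e h i) (hw : Phi p e h f w = 0) (i j : Fin (p-1))
    (hij : j ≤ i) : w i j = 0 := by
  let w' : ℕ → ℕ → V := fun i j =>
    if hh : i < p-1 ∧ j < p-1 then (w ⟨i, hh.1⟩ ⟨j, hh.2⟩ : V) else 0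
  have h1 := T.inj hp w' (by
    intro i j
    simp only [w']
    split_ifs with hh
    · exact (w ⟨i, hh.1⟩ ⟨j, hh.2⟩).2
    · exact Submodule.zero_mem _) (by
    rw [← hw, Phi_apply, Finset.sum_range]
    refine Finset.sum_congr rfl fun i _ => ?_
    rw [Finset.sum_range]
    refine Finset.sum_congr rfl fun j _ => ?_
    simp [w']) i i.2 j hij
  simpa [w'] using h1

theorem exists_g [FiniteDimensional k V] {h' f' : Module.End k V} (T : NTri p e h f)
    (T' : NTri p e h' f') (hp : p.Prime) (hp2 : 2 < p) [CharP k p]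
    (φ : ∀ i : Fin (p-1), K e h i ≃ₗ[k] K e h' i) :
    ∃ g : Module.End k V, ∀ (i : Fin (p-1)) (j : ℕ) (u : K e h i),
      g ((f^j) (u : V)) = (f'^j) (φ i u : V) := by
  obtain ⟨s, hs⟩ := LinearMap.exists_rightInverse_of_surjective (Phi p e h f)
    (LinearMap.range_eq_top.2 (T.Phi_surj hp hp2))
  let Ψ : (∀ i : Fin (p-1), Fin (p-1) → K e h i) →ₗ[k] (∀ i : Fin (p-1), Fin (p-1) → K e h' i) :=
    LinearMap.pi fun i => LinearMap.pi fun j =>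
      (φ i).toLinearMap ∘ₗ LinearMap.proj j ∘ₗ LinearMap.proj i
  have hΨ : ∀ w i j, Ψ w i j = φ i (w i j) := fun w i j => rfl
  have hk : ∀ w, Phi p e h f w = 0 → Phi p e h' f' (Ψ w) = 0 := by
    intro w hw
    rw [Phi_apply]
    refine Finset.sum_eq_zero fun i _ => Finset.sum_eq_zero fun j _ => ?_
    rw [hΨ]
    by_cases hij : j ≤ i
    · rw [T.Phi_inj hp w hw i j hij]; simp
    · obtain ⟨a, b⟩ := mem_K.1 (φ i (w i j)).2
      have hij' : (i:ℕ) < j := by simpa using hij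
      rw [show (j:ℕ) = (j-i-1)+(i+1) by omega, pow_add, Module.End.mul_apply,
        T'.fkill hp i.2 a b, map_zero]
  have hg : ∀ w, Phi p e h' f' (Ψ (s (Phi p e h f w))) = Phi p e h' f' (Ψ w) := by
    intro w
    rw [← sub_eq_zero, ← map_sub, ← map_sub]
    apply hk
    rw [map_sub, ← LinearMap.comp_apply, hs]; simp
  refine ⟨Phi p e h' f' ∘ₗ Ψ ∘ₗ s, fun i j u => ?_⟩
  by_cases hj : j < p - 1
  · have := hg (Pi.single i (Pi.single ⟨j, hj⟩ u))
    rw [Phi_single] at this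
    have h2 : Ψ (Pi.single i (Pi.single ⟨j, hj⟩ u)) = Pi.single i (Pi.single ⟨j, hj⟩ (φ i u)) := by
      funext a b
      rw [hΨ]
      by_cases ha : a = i
      · subst ha
        by_cases hb : b = ⟨j, hj⟩
        · subst hb; simp
        · simp [hb]
      · simp [ha]
    rw [h2, Phi_single] at this
    exact this
  · have z : ∀ {F : Module.End k V}, F^(p-1) = 0 → F^j = 0 := fun hF =>
      pow_eq_zero_of_le (by omega) hF
    rw [z T.fp, z T'.fp]; simp

theorem unique [FiniteDimensional k V] {h' f' : Module.End k V} (T : NTri p e h f)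
    (T' : NTri p e h' f') (hp : p.Prime) (hp2 : 2 < p) [CharP k p] :
    ∃ g : (Module.End k V)ˣ, (g : Module.End k V) * e = e * g ∧ (g : Module.End k V) * f = f' * g := by
  let φ : ∀ i : Fin (p-1), K e h i ≃ₗ[k] K e h' i := fun i =>
    LinearEquiv.ofFinrankEq _ _ (le_antisymm (T.finrank_le T' hp hp2 i.2) (T'.finrank_le T hp hp2 i.2))
  obtain ⟨g, hg⟩ := T.exists_g T' hp hp2 φ
  obtain ⟨g', hg'⟩ := T'.exists_g T hp hp2 (fun i => (φ i).symm)
  have ext1 : ∀ {e h f : Module.End k V}, NTri p e h f → ∀ A B : Module.End k V,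
      (∀ (i : Fin (p-1)) (j : ℕ) (u : K e h i), A ((f^j) (u:V)) = B ((f^j) (u:V))) → A = B := by
    intro e h f T A B hAB
    ext v
    exact T.span_top hp hp2 (LinearMap.eqLocus A B) (fun i j u hi hj a b =>
      hAB ⟨i, hi⟩ j ⟨u, mem_K.2 ⟨a, b⟩⟩) v
  refine ⟨⟨g, g', ?_, ?_⟩, ?_, ?_⟩
  · refine ext1 T' _ _ fun i j u => ?_
    simp [hg', hg]
  · refine ext1 T _ _ fun i j u => ?_
    simp [hg', hg]
  · refine ext1 T _ _ fun i j u => ?_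
    simp only [Module.End.mul_apply, hg]
    obtain ⟨a, b⟩ := mem_K.1 u.2
    obtain ⟨a', b'⟩ := mem_K.1 (φ i u).2
    cases j with
    | zero => simp [a, a']
    | succ j =>
      rw [T.efpow, T'.efpow, a, a', b, b']
      simp [hg]
  · refine ext1 T _ _ fun i j u => ?_
    simp only [Module.End.mul_apply, hg]
    rw [← Module.End.mul_apply f, ← pow_succ', hg, pow_succ', Module.End.mul_apply]

end NTri

namespace NEx
variable {k : Type*} [Field k]

noncomputable def F0 (k : Type*) [Field k] (d : ℕ) : Module.End k k[X] :=
  ((d:k) - 1) • (derivative : k[X] →ₗ[k] k[X]) -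
    LinearMap.mulLeft k (X : k[X]) ∘ₗ (derivative : k[X] →ₗ[k] k[X]) ∘ₗ derivative

noncomputable def H0 (k : Type*) [Field k] (d : ℕ) : Module.End k k[X] :=
  (2:k) • LinearMap.mulLeft k (X : k[X]) ∘ₗ (derivative : k[X] →ₗ[k] k[X]) -
    ((d:k) - 1) • LinearMap.id

theorem F0_apply (d : ℕ) (q : k[X]) : F0 k d q = C ((d:k)-1) * derivative q -
    X * derivative (derivative q) := by
  simp [F0, smul_eq_C_mul]

theorem H0_apply (d : ℕ) (q : k[X]) : H0 k d q = C 2 * (X * derivative q) - C ((d:k)-1) * q := by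
  simp [H0, smul_eq_C_mul]

theorem F0_pow (d j : ℕ) : F0 k d (X^(j+1)) = C ((j+1:k) * ((d:k) - (j+1))) * X^j := by
  rw [F0_apply]
  cases j with
  | zero => simp
  | succ j => simp; ring

theorem F0_zero (d : ℕ) : F0 k d 1 = 0 := by
  rw [F0_apply]; simp

theorem F0_nil (d m j : ℕ) (h : j < m) : (F0 k d ^ m) (X^j) = 0 := by
  induction m generalizing j with
  | zero => omega
  | succ m ih =>
    rw [pow_succ, Module.End.mul_apply]
    cases j with
    | zero => simp [F0_zero]
    | succ j => rw [F0_pow, ← smul_eq_C_mul, map_smul, ih _ (by omega), smul_zero]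

theorem F0_ideal (d : ℕ) (q : k[X]) (hq : X^d ∣ q) : X^d ∣ F0 k d q := by
  obtain ⟨r, rfl⟩ := hq
  induction r using Polynomial.induction_on' with
  | add a b ha hb => rw [mul_add, map_add]; exact dvd_add ha hb
  | monomial n a =>
    rw [← C_mul_X_pow_eq_monomial, mul_left_comm, ← pow_add, ← smul_eq_C_mul, map_smul,
      smul_eq_C_mul]
    refine Dvd.dvd.mul_left ?_ _
    cases n with
    | zero =>
      cases d with
      | zero => simp
      | succ d => rw [add_zero, F0_pow]; simp
    | succ n => rw [← add_assoc, F0_pow]; exact Dvd.dvd.mul_left (pow_dvd_pow _ (by omega)) _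

theorem F0_ideal_pow (d m : ℕ) (q : k[X]) (hq : X^d ∣ q) : X^d ∣ (F0 k d ^ m) q := by
  induction m with
  | zero => simpa
  | succ m ih => rw [pow_succ', Module.End.mul_apply]; exact F0_ideal d _ ih

theorem F0_nil_ideal (d m : ℕ) (h : d ≤ m) (q : k[X]) : X^d ∣ (F0 k d ^ m) q := by
  induction q using Polynomial.induction_on' with
  | add a b ha hb => rw [map_add]; exact dvd_add ha hb
  | monomial n a =>
    rw [← C_mul_X_pow_eq_monomial, ← smul_eq_C_mul, map_smul, smul_eq_C_mul]
    refine Dvd.dvd.mul_left ?_ _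
    by_cases hn : n < m
    · rw [F0_nil d m n hn]; exact dvd_zero _
    · exact F0_ideal_pow d m _ (pow_dvd_pow _ (by omega))

theorem H0_ideal (d : ℕ) (q : k[X]) (hq : X^d ∣ q) : X^d ∣ H0 k d q := by
  obtain ⟨r, rfl⟩ := hq
  rw [H0_apply]
  refine dvd_sub ?_ (Dvd.dvd.mul_left (Dvd.intro _ rfl) _)
  refine Dvd.dvd.mul_left ?_ _
  rw [derivative_mul, mul_add]
  refine dvd_add ?_ ?_
  · cases d with
    | zero => simp
    | succ d =>
      refine ⟨C ((d+1 : ℕ):k) * r, ?_⟩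
      simp; ring
  · exact ⟨X * derivative r, by ring⟩

abbrev Q (k : Type*) [Field k] (d : ℕ) := k[X] ⧸ (Submodule.span k[X] {(X:k[X])^d})

theorem exQ (d N : ℕ) (hd : d ≤ N) : ∃ H F : Module.End k (Q k d),
    (∀ v, H ((X:k[X]) • v) = (X:k[X]) • H v + (2:k) • ((X:k[X]) • v)) ∧
    (∀ v, H (F v) = F (H v) - (2:k) • F v) ∧
    (∀ v, (X:k[X]) • F v = F ((X:k[X]) • v) + H v) ∧ F ^ N = 0 := by
  let S : Submodule k[X] k[X] := Submodule.span k[X] {(X:k[X])^d}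
  have memS : ∀ q, q ∈ S ↔ X^d ∣ q := fun q => Ideal.mem_span_singleton
  let S' := S.restrictScalars k
  let r : (k[X] ⧸ S') ≃ₗ[k] (Q k d) := Submodule.Quotient.restrictScalarsEquiv k S
  have hr : ∀ q, r (Submodule.Quotient.mk q) = Submodule.Quotient.mk q := fun q => rfl
  have hr' : ∀ q, r.symm (Submodule.Quotient.mk q) = Submodule.Quotient.mk q := fun q => rfl
  let lift : ∀ A : Module.End k k[X], (∀ q, X^d ∣ q → X^d ∣ A q) → Module.End k (Q k d) :=
    fun A hA => r.toLinearMap ∘ₗ Submodule.mapQ S' S' A (fun q hq => (memS _).2 (hA q ((memS q).1 hq)))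
      ∘ₗ r.symm.toLinearMap
  have hl : ∀ A hA q, lift A hA (Submodule.Quotient.mk q) = Submodule.Quotient.mk (A q) :=
    fun A hA q => rfl
  have mk_ks : ∀ (c : k) (q : k[X]), c • (Submodule.Quotient.mk q : Q k d) =
    Submodule.Quotient.mk (c • q) := fun c q => rfl
  have hlH := hl (H0 k d) (H0_ideal d)
  have hlF := hl (F0 k d) (F0_ideal d)
  refine ⟨lift (H0 k d) (H0_ideal d), lift (F0 k d) (F0_ideal d), ?_, ?_, ?_, ?_⟩
  · intro v
    obtain ⟨q, rfl⟩ := Submodule.Quotient.mk_surjective _ v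
    rw [hlH, ← Submodule.Quotient.mk_smul, ← Submodule.Quotient.mk_smul, hlH, mk_ks,
      ← Submodule.Quotient.mk_add]
    congr 1
    simp only [H0_apply, smul_eq_mul, smul_eq_C_mul, derivative_mul, derivative_X]
    ring
  · intro v
    obtain ⟨q, rfl⟩ := Submodule.Quotient.mk_surjective _ v
    rw [hlF, hlH, hlH, hlF, mk_ks, ← Submodule.Quotient.mk_sub]
    congr 1
    simp only [H0_apply, F0_apply, smul_eq_mul, smul_eq_C_mul, derivative_mul, derivative_X,
      derivative_sub, derivative_C, derivative_add, zero_mul, zero_add, one_mul]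
    simp only [map_ofNat]
    ring
  · intro v
    obtain ⟨q, rfl⟩ := Submodule.Quotient.mk_surjective _ v
    rw [hlF, hlH, ← Submodule.Quotient.mk_smul, ← Submodule.Quotient.mk_smul, hlF,
      ← Submodule.Quotient.mk_add]
    congr 1
    simp only [H0_apply, F0_apply, smul_eq_mul, smul_eq_C_mul, derivative_mul, derivative_X,
      derivative_sub, derivative_C, derivative_add, zero_mul, zero_add, one_mul]
    simp only [map_ofNat]
    ring
  · apply LinearMap.ext
    intro v
    obtain ⟨q, rfl⟩ := Submodule.Quotient.mk_surjective _ v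
    have : ∀ m q, ((lift (F0 k d) (F0_ideal d)) ^ m) (Submodule.Quotient.mk q) =
        Submodule.Quotient.mk ((F0 k d ^ m) q) := by
      intro m q
      induction m with
      | zero => rfl
      | succ m ih => rw [pow_succ', Module.End.mul_apply, ih, hlF, pow_succ', Module.End.mul_apply]
    rw [this]
    exact (Submodule.Quotient.mk_eq_zero _).2 ((memS _).2 (F0_nil_ideal d N hd q))

theorem exists_decomp {V : Type*} [AddCommGroup V] [Module k V] [FiniteDimensional k V]
    (e : Module.End k V) (N : ℕ) (he : e ^ N = 0) :
    ∃ (t : ℕ) (d : Fin t → ℕ) (ψ : V ≃ₗ[k] (∀ i : Fin t, Q k (d i))),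
      (∀ v i, ψ (e v) i = (X:k[X]) • ψ v i) ∧ ∀ i, d i ≤ N := by
  have tor : Module.IsTorsion' (Module.AEval' e) (Submonoid.powers (X:k[X])) := by
    intro x
    refine ⟨⟨X^N, N, rfl⟩, ?_⟩
    obtain ⟨v, rfl⟩ := (Module.AEval'.of e).surjective x
    change (X^N : k[X]) • (Module.AEval'.of e v) = 0
    rw [Module.AEval'.X_pow_smul_of, he]; simp
  obtain ⟨t, d, ⟨ρ⟩⟩ := Module.torsion_by_prime_power_decomposition (R := k[X])
    (irreducible_X) tor
  let ρ' : Module.AEval' e ≃ₗ[k[X]] (∀ i : Fin t, Q k (d i)) :=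
    ρ.trans (DirectSum.linearEquivFunOnFintype k[X] (Fin t) (fun i => Q k (d i)))
  refine ⟨t, d, (Module.AEval'.of e).trans (ρ'.restrictScalars k), ?_, ?_⟩
  · intro v i
    change ρ' (Module.AEval'.of e (e v)) i = _ • ρ' (Module.AEval'.of e v) i
    rw [← Module.AEval'.X_smul_of, map_smul]; rfl
  · intro i
    let x : Module.AEval' e := ρ'.symm (fun _ => Submodule.Quotient.mk 1)
    have hx : (X^N : k[X]) • x = 0 := by
      obtain ⟨v, hv⟩ := (Module.AEval'.of e).surjective x
      rw [← hv, Module.AEval'.X_pow_smul_of, he]; simp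
    have h2 := congrFun (congrArg ρ' hx) i
    rw [map_smul, LinearEquiv.apply_symm_apply, map_zero, Pi.smul_apply,
      ← Submodule.Quotient.mk_smul, Pi.zero_apply, Submodule.Quotient.mk_eq_zero,
      Ideal.mem_span_singleton, smul_eq_mul, mul_one] at h2
    exact (pow_dvd_pow_iff X_ne_zero not_isUnit_X).1 h2
end NEx

theorem NTri.exists_tri {k V : Type*} [Field k] [AddCommGroup V] [Module k V]
    [FiniteDimensional k V] (p : ℕ) (e : Module.End k V) (he : e ^ (p-1) = 0) :
    ∃ h f : Module.End k V, NTri p e h f := by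
  obtain ⟨t, d, ψ, hψ, hd⟩ := NEx.exists_decomp e (p-1) he
  choose H F h1 h2 h3 h4 using fun i => NEx.exQ (k := k) (d i) (p-1) (hd i)
  let lift : (∀ i, Module.End k (NEx.Q k (d i))) → Module.End k V := fun A =>
    ψ.symm.toLinearMap ∘ₗ (LinearMap.pi fun i => A i ∘ₗ LinearMap.proj i) ∘ₗ ψ.toLinearMap
  have hl : ∀ A v i, ψ (lift A v) i = A i (ψ v i) := by
    intro A v i
    simp [lift]
  refine ⟨lift H, lift F, ⟨?_, ?_, ?_, he, ?_⟩⟩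
  · intro v
    apply ψ.injective; funext i
    simp only [hl, map_add, map_smul, Pi.add_apply, Pi.smul_apply, hψ, h1]
  · intro v
    apply ψ.injective; funext i
    simp only [hl, map_sub, map_smul, Pi.sub_apply, Pi.smul_apply, h2]
  · intro v
    apply ψ.injective; funext i
    simp only [hl, map_add, Pi.add_apply, hψ, h3]
  · have : ∀ m v i, ψ ((lift F ^ m) v) i = (F i ^ m) (ψ v i) := by
      intro m v i
      induction m with
      | zero => rfl
      | succ m ih => rw [pow_succ', Module.End.mul_apply, hl, ih, pow_succ', Module.End.mul_apply]
    apply LinearMap.ext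
    intro v
    apply ψ.injective; funext i
    rw [this, h4]; simp

theorem NTri.of_matrix {k : Type*} [Field k] {n p : ℕ} {e h f : Matrix (Fin n) (Fin n) k}
    (he : e ^ (p-1) = 0) (hf : f ^ (p-1) = 0)
    (H : h * e - e * h = 2 • e ∧ h * f - f * h = -(2 • f) ∧ e * f - f * e = h) :
    NTri p (Matrix.toLinAlgEquiv' e) (Matrix.toLinAlgEquiv' h) (Matrix.toLinAlgEquiv' f) := by
  obtain ⟨a, b, c⟩ := H
  refine ⟨fun v => ?_, fun v => ?_, fun v => ?_, ?_, ?_⟩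
  · have := congrArg (fun M => Matrix.toLinAlgEquiv' M v) (sub_eq_iff_eq_add.1 a)
    simp only [map_mul, map_add, map_nsmul, Module.End.mul_apply, LinearMap.add_apply,
      LinearMap.smul_apply] at this
    rw [this]; module
  · have := congrArg (fun M => Matrix.toLinAlgEquiv' M v) (sub_eq_iff_eq_add.1 b)
    simp only [map_mul, map_add, map_neg, map_nsmul, Module.End.mul_apply, LinearMap.add_apply,
      LinearMap.smul_apply, LinearMap.neg_apply] at this
    rw [this]; module
  · have := congrArg (fun M => Matrix.toLinAlgEquiv' M v) (sub_eq_iff_eq_add.1 c)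
    simp only [map_mul, map_add, Module.End.mul_apply, LinearMap.add_apply] at this
    rw [this, add_comm]
  · rw [← map_pow, he, map_zero]
  · rw [← map_pow, hf, map_zero]

/-- Let `k` be algebraically closed of characteristic `p > 2` and
`G = GL_n(k)`.  For every nilpotent `e ∈ gl_n(k)` with `e^{p-1} = 0` there exist
`h, f` with `f^{p-1} = 0` completing `e` to an `sl₂`-triple, and any two such
`sl₂`-triples `(e, h, f)`, `(e, h', f')` with `f^{p-1} = (f')^{p-1} = 0` are
conjugate by an element of `GL_n(k)` fixing `e`.  (This is the `sl₂`-property for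
`N^{p-1}` in type `GL_n`.) -/
theorem gln_sl2_property_Npm1
    (k : Type*) [Field k] [IsAlgClosed k] (p : ℕ) (hp : p.Prime) (hp2 : 2 < p)
    [CharP k p] (n : ℕ) (hn : 0 < n) :
    -- existence:
    (∀ e : Matrix (Fin n) (Fin n) k, e ^ (p - 1) = 0 →
      ∃ h f : Matrix (Fin n) (Fin n) k, f ^ (p - 1) = 0 ∧
        h * e - e * h = 2 • e ∧ h * f - f * h = -(2 • f) ∧ e * f - f * e = h) ∧
    -- uniqueness up to conjugacy by the centralizer of `e` in `GL_n(k)`: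
    (∀ e h f h' f' : Matrix (Fin n) (Fin n) k,
      e ^ (p - 1) = 0 → f ^ (p - 1) = 0 → f' ^ (p - 1) = 0 →
      (h * e - e * h = 2 • e ∧ h * f - f * h = -(2 • f) ∧ e * f - f * e = h) →
      (h' * e - e * h' = 2 • e ∧ h' * f' - f' * h' = -(2 • f') ∧
        e * f' - f' * e = h') →
      ∃ g : (Matrix (Fin n) (Fin n) k)ˣ,
        (g : Matrix (Fin n) (Fin n) k) * e * ((g⁻¹ : (Matrix (Fin n) (Fin n) k)ˣ) : Matrix (Fin n) (Fin n) k) = e ∧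
        (g : Matrix (Fin n) (Fin n) k) * h * ((g⁻¹ : (Matrix (Fin n) (Fin n) k)ˣ) : Matrix (Fin n) (Fin n) k) = h' ∧
        (g : Matrix (Fin n) (Fin n) k) * f * ((g⁻¹ : (Matrix (Fin n) (Fin n) k)ˣ) : Matrix (Fin n) (Fin n) k) = f') := by
  constructor
  · intro e he
    obtain ⟨h, f, T⟩ := NTri.exists_tri p (Matrix.toLinAlgEquiv' e)
      (by rw [← map_pow, he, map_zero])
    obtain ⟨h, rfl⟩ := (Matrix.toLinAlgEquiv' (R := k) (n := Fin n)).surjective h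
    obtain ⟨f, rfl⟩ := (Matrix.toLinAlgEquiv' (R := k) (n := Fin n)).surjective f
    have inj := (Matrix.toLinAlgEquiv' (R := k) (n := Fin n)).injective
    refine ⟨h, f, ?_, ?_, ?_, ?_⟩
    · apply inj; rw [map_pow, T.fp, map_zero]
    · apply inj
      refine LinearMap.ext fun v => ?_
      have := T.he v
      simp only [map_mul, map_sub, map_nsmul, Module.End.mul_apply, LinearMap.sub_apply,
        LinearMap.smul_apply, this]
      module
    · apply inj
      refine LinearMap.ext fun v => ?_
      have := T.hf v
      simp only [map_mul, map_sub, map_neg, map_nsmul, Module.End.mul_apply, LinearMap.sub_apply,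
        LinearMap.smul_apply, LinearMap.neg_apply, this]
      module
    · apply inj
      refine LinearMap.ext fun v => ?_
      have := T.ef v
      simp only [map_mul, map_sub, Module.End.mul_apply, LinearMap.sub_apply, this]
      module
  · intro e h f h' f' he hf hf' H H'
    obtain ⟨g, hg1, hg2⟩ := (NTri.of_matrix he hf H).unique (NTri.of_matrix he hf' H') hp hp2
    have inj := (Matrix.toLinAlgEquiv' (R := k) (n := Fin n)).injective
    let g0 : (Matrix (Fin n) (Fin n) k)ˣ :=
      Units.map (Matrix.toLinAlgEquiv' (R := k) (n := Fin n)).symm.toMonoidHom g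
    have hg0 : Matrix.toLinAlgEquiv' (g0 : Matrix (Fin n) (Fin n) k) = g :=
      (Matrix.toLinAlgEquiv' (R := k) (n := Fin n)).apply_symm_apply _
    have a : (g0 : Matrix (Fin n) (Fin n) k) * e = e * g0 := by
      apply inj; rw [map_mul, map_mul, hg0, hg1]
    have b : (g0 : Matrix (Fin n) (Fin n) k) * f = f' * g0 := by
      apply inj; rw [map_mul, map_mul, hg0, hg2]
    refine ⟨g0, ?_, ?_, ?_⟩
    · rw [Units.mul_inv_eq_iff_eq_mul, a]
    · rw [Units.mul_inv_eq_iff_eq_mul, ← H.2.2, ← H'.2.2, mul_sub, sub_mul, ← mul_assoc, a,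
        mul_assoc, b, ← mul_assoc _ f e, b, mul_assoc f', a]
      simp only [mul_assoc]
    · rw [Units.mul_inv_eq_iff_eq_mul, b]
end
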